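/- arXiv:math/0406372 — 14 statements merged into one kernel-verified Lean document; each statement's English description precedes it below -/
import Mathlib

section
/- Let a < b be real numbers and n ≥ 1 a natural number. Suppose f : ℝ → ℝ is such that for each k ≤ n the k-th derivative f^{(k)} exists at every point of [a,b], and f^{(n)} is interval-integrable on [a,b]. Let x₀ ∈ [a,b]. Then for all x ∈ [a,b], R_{n,x₀}(x) = (1/(n-1)!) ∫_a^x [f^{(n)}(t) - f^{(n)}(x₀)](x-t)^{n-1} dt. -/
open MeasureTheory intervalIntegral

/-- The derivative of `(x - t) ^ (m + 1) / (m + 1)!` with respect to `t`. -/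
theorem hasDerivAt_sub_pow_div_factorial (x t : ℝ) (m : ℕ) :
    HasDerivAt (fun s : ℝ => (x - s) ^ (m + 1) / (Nat.factorial (m + 1) : ℝ))
      (-((x - t) ^ m / (Nat.factorial m : ℝ))) t := by
  have h := (((hasDerivAt_id t).const_sub x).pow (m + 1)).div_const (Nat.factorial (m + 1) : ℝ)
  refine h.congr_deriv ?_
  have hm : (Nat.factorial m : ℝ) ≠ 0 := by positivity
  rw [Nat.factorial_succ]
  push_cast
  simp only [id_eq]
  field_simp

/-- Differentiating the Taylor polynomial at `x` with respect to its centre telescopes. -/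
theorem hasDerivAt_taylor_sum_center {f : ℝ → ℝ} {t : ℝ} (x : ℝ) (m : ℕ)
    (hf : ∀ k ≤ m, HasDerivAt (iteratedDeriv k f) (iteratedDeriv (k + 1) f t) t) :
    HasDerivAt
      (fun s => ∑ k ∈ Finset.range (m + 1),
        iteratedDeriv k f s * ((x - s) ^ k / (Nat.factorial k : ℝ)))
      (iteratedDeriv (m + 1) f t * ((x - t) ^ m / (Nat.factorial m : ℝ))) t := by
  induction m with
  | zero => simpa using hf 0 le_rfl
  | succ m ih =>
    simp only [Finset.sum_range_succ _ (m + 1)]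
    refine ((ih fun k hk => hf k (by lia)).add
      ((hf (m + 1) le_rfl).mul (hasDerivAt_sub_pow_div_factorial x t m))).congr_deriv ?_
    ring

/-- Integral form of the modified remainder `R_{n,x₀}`. -/
theorem modified_remainder_integral_form
    (a b : ℝ) (hab : a < b) (n : ℕ) (hn : 1 ≤ n) (f : ℝ → ℝ)
    (hderiv : ∀ k < n, ∀ x ∈ Set.Icc a b,
      HasDerivAt (iteratedDeriv k f) (iteratedDeriv (k + 1) f x) x)
    (hint : IntervalIntegrable (iteratedDeriv n f) volume a b)
    (x₀ : ℝ) (hx₀ : x₀ ∈ Set.Icc a b) :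
    ∀ x ∈ Set.Icc a b,
      f x - ((∑ k ∈ Finset.range n,
                iteratedDeriv k f a * (x - a) ^ k / (Nat.factorial k : ℝ)) +
             iteratedDeriv n f x₀ * (x - a) ^ n / (Nat.factorial n : ℝ)) =
        (1 / (Nat.factorial (n - 1) : ℝ)) *
          ∫ t in a..x,
            (iteratedDeriv n f t - iteratedDeriv n f x₀) * (x - t) ^ (n - 1) := by
  intro x hx
  obtain ⟨m, rfl⟩ : ∃ m, n = m + 1 := ⟨n - 1, by lia⟩
  have hsub : Set.uIcc a x ⊆ Set.Icc a b := by
    rw [Set.uIcc_of_le hx.1]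
    exact Set.Icc_subset_Icc_right hx.2
  have hderiv_center : ∀ t ∈ Set.uIcc a x, HasDerivAt
      (fun s => (∑ k ∈ Finset.range (m + 1),
          iteratedDeriv k f s * ((x - s) ^ k / (Nat.factorial k : ℝ))) +
        iteratedDeriv (m + 1) f x₀ * ((x - s) ^ (m + 1) / (Nat.factorial (m + 1) : ℝ)))
      ((1 / (Nat.factorial m : ℝ)) *
        ((iteratedDeriv (m + 1) f t - iteratedDeriv (m + 1) f x₀) * (x - t) ^ m)) t := by
    intro t ht
    refine ((hasDerivAt_taylor_sum_center x m fun k hk =>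
      hderiv k (by lia) t (hsub ht)).add
        ((hasDerivAt_sub_pow_div_factorial x t m).const_mul _)).congr_deriv ?_
    ring
  have hint_x : IntervalIntegrable (iteratedDeriv (m + 1) f) volume a x :=
    hint.mono_set (by rwa [Set.uIcc_of_le hab.le])
  have hint_rem : IntervalIntegrable (fun t => (1 / (Nat.factorial m : ℝ)) *
      ((iteratedDeriv (m + 1) f t - iteratedDeriv (m + 1) f x₀) * (x - t) ^ m)) volume a x :=
    ((hint_x.sub intervalIntegrable_const).mul_continuousOn (by fun_prop)).const_mul _
  have hFTC := integral_eq_sub_of_hasDerivAt hderiv_center hint_rem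
  rw [intervalIntegral.integral_const_mul] at hFTC
  rw [Nat.add_sub_cancel, hFTC]
  simp [Finset.sum_range_succ', mul_div_assoc]
end

section
/- Let a < b be real numbers and n ≥ 1 a natural number. Suppose f : ℝ → ℝ is such that for each k ≤ n the k-th derivative f^{(k)} exists at every point of [a,b], and f^{(n)} is interval-integrable on [a,b]. Let x₀ ∈ [a,b]. Then ‖R_{n,x₀}‖ ≤ ((b-a)^n / n!) · ‖f^{(n)}(·) - f^{(n)}(x₀)‖, where both Alexiewicz norms are taken over [a,b]. -/
open MeasureTheory intervalIntegral

/-- The polynomial `∑ k < n, u k (x - a)^k / k! + c (x - a)^n / n!`. -/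
noncomputable def modifiedTaylorPolynomial (a c : ℝ) (n : ℕ) (u : ℕ → ℝ) (x : ℝ) : ℝ :=
  (∑ k ∈ Finset.range n, u k * (x - a) ^ k / (Nat.factorial k : ℝ)) +
    c * (x - a) ^ n / (Nat.factorial n : ℝ)

theorem hasDerivAt_mul_sub_pow_div_factorial (a c x : ℝ) (k : ℕ) :
    HasDerivAt (fun y : ℝ => c * (y - a) ^ (k + 1) / (Nat.factorial (k + 1) : ℝ))
      (c * (x - a) ^ k / (Nat.factorial k : ℝ)) x := by
  have h := ((((hasDerivAt_id x).sub_const a).pow (k + 1)).const_mul c).div_const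
    (Nat.factorial (k + 1) : ℝ)
  refine h.congr_deriv ?_
  have hk : (Nat.factorial k : ℝ) ≠ 0 := by positivity
  have hk' : (k + 1 : ℝ) ≠ 0 := by positivity
  simp only [Nat.factorial_succ, Nat.cast_mul, Nat.cast_add, Nat.cast_one, id,
    Nat.add_sub_cancel]
  field_simp

theorem hasDerivAt_modifiedTaylorPolynomial_succ (a c : ℝ) (n : ℕ) (u : ℕ → ℝ) (x : ℝ) :
    HasDerivAt (modifiedTaylorPolynomial a c (n + 1) u)
      (modifiedTaylorPolynomial a c n (fun k => u (k + 1)) x) x := by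
  have hsum : HasDerivAt
      (fun y => ∑ k ∈ Finset.range n, u (k + 1) * (y - a) ^ (k + 1) / (Nat.factorial (k + 1) : ℝ))
      (∑ k ∈ Finset.range n, u (k + 1) * (x - a) ^ k / (Nat.factorial k : ℝ)) x :=
    HasDerivAt.fun_sum fun k _ => hasDerivAt_mul_sub_pow_div_factorial a (u (k + 1)) x k
  have h := (hsum.add_const (u 0)).add (hasDerivAt_mul_sub_pow_div_factorial a c x n)
  refine h.congr_of_eventuallyEq (Filter.Eventually.of_forall fun y => ?_)
  simp [modifiedTaylorPolynomial, Finset.sum_range_succ']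

theorem modifiedTaylorPolynomial_succ_self (a c : ℝ) (n : ℕ) (u : ℕ → ℝ) :
    modifiedTaylorPolynomial a c (n + 1) u a = u 0 := by
  simp [modifiedTaylorPolynomial, Finset.sum_range_succ']

theorem continuous_modifiedTaylorPolynomial (a c : ℝ) (n : ℕ) (u : ℕ → ℝ) :
    Continuous (modifiedTaylorPolynomial a c n u) := by
  unfold modifiedTaylorPolynomial
  fun_prop

/-- If the primitive of `F n - c` is bounded by `M` on `[a, b]`, where each `F (k + 1)` is the
derivative of `F k`, then the primitive of the modified Taylor remainder of `F 0` is bounded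
by `M (x - a)^n / n!`. -/
theorem abs_integral_sub_modifiedTaylorPolynomial_le {a b c M : ℝ} (n : ℕ) (F : ℕ → ℝ → ℝ)
    (hderiv : ∀ k < n, ∀ x ∈ Set.Icc a b, HasDerivAt (F k) (F (k + 1) x) x)
    (hint : IntervalIntegrable (F n) volume a b)
    (hM : ∀ x ∈ Set.Icc a b, |∫ t in a..x, (F n t - c)| ≤ M)
    {x : ℝ} (hx : x ∈ Set.Icc a b) :
    |∫ t in a..x, (F 0 t - modifiedTaylorPolynomial a c n (fun k => F k a) t)| ≤
      M * (x - a) ^ n / (Nat.factorial n : ℝ) := by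
  induction n generalizing F x with
  | zero => simpa [modifiedTaylorPolynomial] using hM x hx
  | succ n ih =>
    have hab : a ≤ b := hx.1.trans hx.2
    have hint_one : IntervalIntegrable (F 1) volume a b := by
      rcases n.eq_zero_or_pos with rfl | hn
      · exact hint
      · refine ContinuousOn.intervalIntegrable fun y hy => ?_
        rw [Set.uIcc_of_le hab] at hy
        exact (hderiv 1 (by omega) y hy).continuousAt.continuousWithinAt
    have hremainder : ∀ y ∈ Set.Icc a b,
        |F 0 y - modifiedTaylorPolynomial a c (n + 1) (fun k => F k a) y| ≤
          M * (y - a) ^ n / (Nat.factorial n : ℝ) := by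
      intro y hy
      have hsub : Set.uIcc a y ⊆ Set.Icc a b := by
        rw [Set.uIcc_of_le hy.1]
        exact Set.Icc_subset_Icc_right hy.2
      have hftc := integral_eq_sub_of_hasDerivAt
        (f := fun t => F 0 t - modifiedTaylorPolynomial a c (n + 1) (fun k => F k a) t)
        (fun t ht => (hderiv 0 n.succ_pos t (hsub ht)).sub
          (hasDerivAt_modifiedTaylorPolynomial_succ a c n (fun k => F k a) t))
        ((hint_one.mono_set (by rwa [Set.uIcc_of_le hab])).sub
          ((continuous_modifiedTaylorPolynomial a c n _).intervalIntegrable a y))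
      rw [modifiedTaylorPolynomial_succ_self, sub_self, sub_zero] at hftc
      rw [← hftc]
      exact ih (fun k => F (k + 1)) (fun k hk => hderiv (k + 1) (by omega)) hint hM hy
    have hint_bound : IntervalIntegrable
        (fun t => M * (t - a) ^ n / (Nat.factorial n : ℝ)) volume a x :=
      Continuous.intervalIntegrable (by fun_prop) a x
    have hbound : |∫ t in a..x,
        (F 0 t - modifiedTaylorPolynomial a c (n + 1) (fun k => F k a) t)| ≤
          ∫ t in a..x, M * (t - a) ^ n / (Nat.factorial n : ℝ) := by
      rw [← Real.norm_eq_abs]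
      exact norm_integral_le_of_norm_le hx.1
        (Filter.Eventually.of_forall fun t ht => hremainder t ⟨ht.1.le, ht.2.trans hx.2⟩)
        hint_bound
    refine hbound.trans_eq ?_
    rw [integral_eq_sub_of_hasDerivAt
      (fun t _ => hasDerivAt_mul_sub_pow_div_factorial a M t n)
      hint_bound]
    simp

/-- Alexiewicz-norm estimate for the modified remainder `R_{n,x₀}`. -/
theorem modified_remainder_alexiewicz_estimate
    (a b : ℝ) (hab : a < b) (n : ℕ) (hn : 1 ≤ n) (f : ℝ → ℝ)
    (hderiv : ∀ k < n, ∀ x ∈ Set.Icc a b,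
      HasDerivAt (iteratedDeriv k f) (iteratedDeriv (k + 1) f x) x)
    (hint : IntervalIntegrable (iteratedDeriv n f) volume a b)
    (x₀ : ℝ) (hx₀ : x₀ ∈ Set.Icc a b) :
    (⨆ c : Set.Icc a b, |∫ x in a..(c : ℝ),
        (f x - ((∑ k ∈ Finset.range n,
                  iteratedDeriv k f a * (x - a) ^ k / (Nat.factorial k : ℝ)) +
                iteratedDeriv n f x₀ * (x - a) ^ n / (Nat.factorial n : ℝ)))|) ≤
      ((b - a) ^ n / (Nat.factorial n : ℝ)) *
        ⨆ c : Set.Icc a b, |∫ t in a..(c : ℝ),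
          (iteratedDeriv n f t - iteratedDeriv n f x₀)| := by
  have hcont : ContinuousOn
      (fun x => |∫ t in a..x, (iteratedDeriv n f t - iteratedDeriv n f x₀)|) (Set.Icc a b) := by
    have h := continuousOn_primitive_interval'
      (hint.sub (intervalIntegrable_const (c := iteratedDeriv n f x₀))) Set.left_mem_uIcc
    rw [Set.uIcc_of_le hab.le] at h
    exact h.abs
  have hbdd : BddAbove (Set.range fun c : Set.Icc a b =>
      |∫ t in a..(c : ℝ), (iteratedDeriv n f t - iteratedDeriv n f x₀)|) := by
    have h := isCompact_Icc.bddAbove_image hcont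
    rwa [Set.image_eq_range] at h
  set M := ⨆ c : Set.Icc a b, |∫ t in a..(c : ℝ),
    (iteratedDeriv n f t - iteratedDeriv n f x₀)|
  have hM : ∀ x ∈ Set.Icc a b,
      |∫ t in a..x, (iteratedDeriv n f t - iteratedDeriv n f x₀)| ≤ M :=
    fun x hx => le_ciSup hbdd ⟨x, hx⟩
  have hM_nonneg : 0 ≤ M := (abs_nonneg _).trans (hM x₀ hx₀)
  have : Nonempty (Set.Icc a b) := ⟨⟨x₀, hx₀⟩⟩
  refine ciSup_le fun c => ?_
  have h := abs_integral_sub_modifiedTaylorPolynomial_le n (fun k => iteratedDeriv k f)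
    hderiv hint hM c.2
  simp only [iteratedDeriv_zero, modifiedTaylorPolynomial] at h
  refine h.trans ?_
  rw [div_mul_eq_mul_div, mul_comm]
  have hca : 0 ≤ (c : ℝ) - a := sub_nonneg.2 c.2.1
  have hcb : (c : ℝ) ≤ b := c.2.2
  gcongr
end

section
/- Let a < b be real numbers and n ≥ 1 a natural number. Suppose f : ℝ → ℝ is such that for each k ≤ n the k-th derivative f^{(k)} exists at every point of [a,b], and f^{(n)} is interval-integrable on [a,b]. Let x₀ ∈ [a,b]. Then for all x ∈ [a,b], |R_{n,x₀}(x)| ≤ ((x-a)^{n-1} / (n-1)!) · ‖f^{(n)}(·) - f^{(n)}(x₀)‖_{[a,x]}. -/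
open MeasureTheory intervalIntegral

/-- The degree `n + 1` Taylor-type sum with coefficients `u` and top coefficient `c`
differentiates to the degree `n` sum with shifted coefficients. -/
lemma hasDerivAt_taylor_sum (u : ℕ → ℝ) (a c : ℝ) (n : ℕ) (y : ℝ) :
    HasDerivAt
      (fun y ↦ (∑ k ∈ Finset.range (n + 1), u k * (y - a) ^ k / (Nat.factorial k : ℝ)) +
        c * (y - a) ^ (n + 1) / (Nat.factorial (n + 1) : ℝ))
      ((∑ k ∈ Finset.range n, u (k + 1) * (y - a) ^ k / (Nat.factorial k : ℝ)) +
        c * (y - a) ^ n / (Nat.factorial n : ℝ)) y := by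
  have term (v : ℝ) (k : ℕ) :
      HasDerivAt (fun y ↦ v * (y - a) ^ (k + 1) / (Nat.factorial (k + 1) : ℝ))
        (v * (y - a) ^ k / (Nat.factorial k : ℝ)) y := by
    have h := ((((hasDerivAt_id y).sub_const a).pow (k + 1)).const_mul v).div_const
      (Nat.factorial (k + 1) : ℝ)
    refine h.congr_deriv ?_
    have : (Nat.factorial k : ℝ) ≠ 0 := by positivity
    have : (k : ℝ) + 1 ≠ 0 := by positivity
    simp only [Nat.factorial_succ, id, Nat.add_sub_cancel]
    push_cast
    field_simp
  refine HasDerivAt.add ?_ (term c n)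
  simp only [Finset.sum_range_succ' _ n, pow_zero]
  exact (HasDerivAt.fun_sum fun k _ ↦ term (u (k + 1)) k).add_const _

/-- Taylor remainder estimate for a chain of successive derivatives `F 0, …, F (m + 1)`, in terms
of a bound on the primitive of `F (m + 1) - c`. -/
lemma abs_taylor_remainder_le (m : ℕ) (F : ℕ → ℝ → ℝ) (a x c M : ℝ)
    (hF : ∀ k < m + 1, ∀ y ∈ Set.Icc a x, HasDerivAt (F k) (F (k + 1) y) y)
    (hint : IntervalIntegrable (F (m + 1)) volume a x)
    (hM : ∀ y ∈ Set.Icc a x, |∫ t in a..y, (F (m + 1) t - c)| ≤ M) :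
    ∀ y ∈ Set.Icc a x,
      |F 0 y - ((∑ k ∈ Finset.range (m + 1), F k a * (y - a) ^ k / (Nat.factorial k : ℝ)) +
        c * (y - a) ^ (m + 1) / (Nat.factorial (m + 1) : ℝ))| ≤
        M * (y - a) ^ m / (Nat.factorial m : ℝ) := by
  induction m generalizing F with
  | zero =>
    intro y hy
    have hsub : Set.uIcc a y ⊆ Set.Icc a x := by
      rw [Set.uIcc_of_le hy.1]
      exact Set.Icc_subset_Icc_right hy.2
    have hi : IntervalIntegrable (F 1) volume a y :=
      hint.mono_set (hsub.trans Set.Icc_subset_uIcc)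
    have h := hM y hy
    rw [zero_add, integral_sub hi intervalIntegrable_const,
      integral_eq_sub_of_hasDerivAt (fun t ht ↦ hF 0 one_pos t (hsub ht)) hi,
      intervalIntegral.integral_const, smul_eq_mul] at h
    simpa [sub_sub, mul_comm c] using h
  | succ m ih =>
    have hbound := ih (fun k ↦ F (k + 1)) (fun k hk ↦ hF (k + 1) (by omega)) hint hM
    have hderiv : ∀ y ∈ Set.Icc a x, HasDerivAt _ _ y := fun y hy ↦
      (hF 0 (by omega) y hy).sub (hasDerivAt_taylor_sum (fun k ↦ F k a) a c (m + 1) y)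
    have hB (y : ℝ) : HasDerivAt (fun y ↦ M * (y - a) ^ (m + 1) / (Nat.factorial (m + 1) : ℝ))
        (M * (y - a) ^ m / (Nat.factorial m : ℝ)) y := by
      simpa using hasDerivAt_taylor_sum (fun _ ↦ 0) a M m y
    refine fun y hy ↦ image_norm_le_of_norm_deriv_right_le_deriv_boundary
      (fun y hy ↦ (hderiv y hy).continuousAt.continuousWithinAt)
      (fun y hy ↦ (hderiv y (Set.Ico_subset_Icc_self hy)).hasDerivWithinAt)
      ?_ hB (fun y hy ↦ hbound y (Set.Ico_subset_Icc_self hy)) hy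
    simp [Finset.sum_range_succ']

/-- Pointwise estimate for the modified remainder `R_{n,x₀}` via the
Alexiewicz norm on `[a,x]`. -/
theorem modified_remainder_pointwise_estimate
    (a b : ℝ) (hab : a < b) (n : ℕ) (hn : 1 ≤ n) (f : ℝ → ℝ)
    (hderiv : ∀ k < n, ∀ x ∈ Set.Icc a b,
      HasDerivAt (iteratedDeriv k f) (iteratedDeriv (k + 1) f x) x)
    (hint : IntervalIntegrable (iteratedDeriv n f) volume a b)
    (x₀ : ℝ) (hx₀ : x₀ ∈ Set.Icc a b) :
    ∀ x ∈ Set.Icc a b,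
      |f x - ((∑ k ∈ Finset.range n,
                iteratedDeriv k f a * (x - a) ^ k / (Nat.factorial k : ℝ)) +
              iteratedDeriv n f x₀ * (x - a) ^ n / (Nat.factorial n : ℝ))| ≤
        ((x - a) ^ (n - 1) / (Nat.factorial (n - 1) : ℝ)) *
          ⨆ c : Set.Icc a x, |∫ t in a..(c : ℝ),
            (iteratedDeriv n f t - iteratedDeriv n f x₀)| := by
  intro x hx
  obtain ⟨m, rfl⟩ : ∃ m, n = m + 1 := ⟨n - 1, by omega⟩
  have hsub : Set.Icc a x ⊆ Set.Icc a b := Set.Icc_subset_Icc_right hx.2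
  have hi : IntervalIntegrable (iteratedDeriv (m + 1) f) volume a x :=
    hint.mono_set (by rwa [Set.uIcc_of_le hx.1, Set.uIcc_of_le hab.le])
  have hcont : ContinuousOn
      (fun y ↦ |∫ t in a..y, (iteratedDeriv (m + 1) f t - iteratedDeriv (m + 1) f x₀)|)
      (Set.Icc a x) := by
    have h := continuousOn_primitive_interval'
      (hi.sub (intervalIntegrable_const (c := iteratedDeriv (m + 1) f x₀))) Set.left_mem_uIcc
    rw [Set.uIcc_of_le hx.1] at h
    exact h.abs
  have hbdd := isCompact_Icc.bddAbove_image hcont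
  rw [Set.image_eq_range] at hbdd
  have h := abs_taylor_remainder_le m (fun k ↦ iteratedDeriv k f) a x
    (iteratedDeriv (m + 1) f x₀) _ (fun k hk y hy ↦ hderiv k hk y (hsub hy)) hi
    (fun y hy ↦ le_ciSup hbdd ⟨y, hy⟩) x ⟨hx.1, le_rfl⟩
  rw [iteratedDeriv_zero] at h
  refine h.trans_eq ?_
  rw [Nat.add_sub_cancel, mul_div_assoc, mul_comm]
end

section
/- Let a < b be real numbers, n ≥ 1 a natural number, and 1 ≤ p < ∞ a real number. Suppose f : ℝ → ℝ is such that for each k ≤ n the k-th derivative f^{(k)} exists at every point of [a,b], and f^{(n)} is interval-integrable on [a,b]. Let x₀ ∈ [a,b]. Then ‖R_{n,x₀}‖_p ≤ ((b-a)^{n-1+1/p} / ((n-1)! · ((n-1)p+1)^{1/p})) · ‖f^{(n)}(·) - f^{(n)}(x₀)‖, where the Alexiewicz norm is taken over [a,b]. -/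
open MeasureTheory intervalIntegral

/-- The Taylor-type polynomial with coefficients `F k a`, `k < n + 1`, and top coefficient `C`
differentiates to the analogous polynomial of the shifted sequence. -/
lemma hasDerivAt_modifiedTaylor (F : ℕ → ℝ → ℝ) (a C x : ℝ) (n : ℕ) :
    HasDerivAt (fun x => (∑ k ∈ Finset.range (n + 1),
        F k a * (x - a) ^ k / (Nat.factorial k : ℝ)) +
        C * (x - a) ^ (n + 1) / (Nat.factorial (n + 1) : ℝ))
      ((∑ k ∈ Finset.range n,
        F (k + 1) a * (x - a) ^ k / (Nat.factorial k : ℝ)) +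
        C * (x - a) ^ n / (Nat.factorial n : ℝ)) x := by
  have hterm (c : ℝ) (k : ℕ) :
      HasDerivAt (fun x => c * (x - a) ^ (k + 1) / (Nat.factorial (k + 1) : ℝ))
        (c * (x - a) ^ k / (Nat.factorial k : ℝ)) x := by
    refine ((((hasDerivAt_id x).sub_const a).fun_pow (k + 1)).const_mul c |>.div_const
      (Nat.factorial (k + 1) : ℝ)).congr_deriv ?_
    have h1 : (Nat.factorial k : ℝ) ≠ 0 := by positivity
    have h2 : (k : ℝ) + 1 ≠ 0 := by positivity
    simp only [Nat.factorial_succ, id, Nat.add_sub_cancel]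
    push_cast
    field_simp
  simp only [Finset.sum_range_succ']
  have hsum := HasDerivAt.fun_sum (u := Finset.range n) fun k _ => hterm (F (k + 1) a) k
  simpa using (hsum.add_const (F 0 a)).fun_add (hterm C n)

/-- A uniform bound `M` on the remainder at the last derivative integrates to a bound
`M (x - a) ^ n / n!` on the modified Taylor remainder. -/
lemma abs_modifiedRemainder_le (a b C M : ℝ) (n : ℕ) (F : ℕ → ℝ → ℝ)
    (hF : ∀ k < n, ∀ x ∈ Set.Icc a b, HasDerivAt (F k) (F (k + 1) x) x)
    (hM : ∀ x ∈ Set.Icc a b, |F n x - (F n a + C * (x - a))| ≤ M) :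
    ∀ x ∈ Set.Icc a b,
      |F 0 x - ((∑ k ∈ Finset.range (n + 1),
        F k a * (x - a) ^ k / (Nat.factorial k : ℝ)) +
        C * (x - a) ^ (n + 1) / (Nat.factorial (n + 1) : ℝ))| ≤
      M * (x - a) ^ n / (Nat.factorial n : ℝ) := by
  induction n generalizing F with
  | zero => simpa using hM
  | succ n ih =>
    have hshift := ih (fun k => F (k + 1)) (fun k hk => hF (k + 1) (by lia)) hM
    have hR (x : ℝ) (hx : x ∈ Set.Icc a b) :=
      (hF 0 (by lia) x hx).sub (hasDerivAt_modifiedTaylor F a C x (n + 1))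
    have hB (x : ℝ) : HasDerivAt
        (fun x => M * (x - a) ^ (n + 1) / (Nat.factorial (n + 1) : ℝ))
        (M * (x - a) ^ n / (Nat.factorial n : ℝ)) x := by
      simpa using hasDerivAt_modifiedTaylor (fun _ _ => 0) a M x n
    refine fun x hx => image_norm_le_of_norm_deriv_right_le_deriv_boundary
      (fun y hy => (hR y hy).continuousAt.continuousWithinAt)
      (fun y hy => (hR y (Set.Ico_subset_Icc_self hy)).hasDerivWithinAt) ?_ hB
      (fun y hy => hshift y (Set.Ico_subset_Icc_self hy)) hx
    simp [Finset.sum_range_succ']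

/-- A pointwise bound by `M (x - a) ^ m / m!` yields the corresponding `L^p` bound. -/
lemma rpow_integral_abs_rpow_le (a b : ℝ) (hab : a < b) (m : ℕ) (p : ℝ) (hp : 1 ≤ p)
    (M : ℝ) (hM : 0 ≤ M) (g : ℝ → ℝ) (hg : ContinuousOn g (Set.Icc a b))
    (hbound : ∀ x ∈ Set.Icc a b, |g x| ≤ M * (x - a) ^ m / (Nat.factorial m : ℝ)) :
    (∫ x in a..b, |g x| ^ p) ^ (1 / p) ≤
      ((b - a) ^ ((m : ℝ) + 1 / p) /
        ((Nat.factorial m : ℝ) * ((m : ℝ) * p + 1) ^ (1 / p))) * M := by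
  have hp0 : 0 < p := by linarith
  have hba : 0 < b - a := sub_pos.2 hab
  have hmp : 0 ≤ (m : ℝ) * p := by positivity
  have hmp1 : 0 < (m : ℝ) * p + 1 := by positivity
  have hfac : (0 : ℝ) < Nat.factorial m := by positivity
  have hle : ∫ x in a..b, |g x| ^ p ≤
      ∫ x in a..b, (M / (Nat.factorial m : ℝ)) ^ p * (x - a) ^ ((m : ℝ) * p) := by
    apply integral_mono_on hab.le
    · apply ContinuousOn.intervalIntegrable
      rw [Set.uIcc_of_le hab.le]
      exact hg.abs.rpow_const fun x _ => Or.inr hp0.le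
    · apply Continuous.intervalIntegrable
      exact continuous_const.mul
        ((continuous_id.sub continuous_const).rpow_const fun x => Or.inr hmp)
    · intro x hx
      have hxa : 0 ≤ x - a := sub_nonneg.2 hx.1
      rw [Real.rpow_mul hxa, Real.rpow_natCast, ← Real.mul_rpow (by positivity) (by positivity)]
      refine Real.rpow_le_rpow (abs_nonneg _) ((hbound x hx).trans_eq ?_) hp0.le
      ring
  have hval : ∫ x in a..b, (M / (Nat.factorial m : ℝ)) ^ p * (x - a) ^ ((m : ℝ) * p) =
      (M / (Nat.factorial m : ℝ)) ^ p * ((b - a) ^ ((m : ℝ) * p + 1) / ((m : ℝ) * p + 1)) := by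
    rw [intervalIntegral.integral_const_mul,
      intervalIntegral.integral_comp_sub_right (fun x => x ^ ((m : ℝ) * p)) a,
      integral_rpow (Or.inl (by linarith)), sub_self, Real.zero_rpow hmp1.ne', sub_zero]
  have hnonneg : 0 ≤ ∫ x in a..b, |g x| ^ p :=
    intervalIntegral.integral_nonneg hab.le fun x _ => by positivity
  refine (Real.rpow_le_rpow hnonneg (hle.trans_eq hval) (by positivity)).trans_eq ?_
  rw [Real.mul_rpow (by positivity) (by positivity), Real.div_rpow (by positivity) hmp1.le,
    ← Real.rpow_mul (by positivity), ← Real.rpow_mul hba.le, mul_one_div_cancel hp0.ne',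
    Real.rpow_one, show ((m : ℝ) * p + 1) * (1 / p) = (m : ℝ) + 1 / p by field_simp]
  field_simp

/-- `L^p`-norm estimate for the modified remainder `R_{n,x₀}` in terms of
the Alexiewicz norm of `f⁽ⁿ⁾(·) - f⁽ⁿ⁾(x₀)`. -/
theorem modified_remainder_Lp_estimate
    (a b : ℝ) (hab : a < b) (n : ℕ) (hn : 1 ≤ n) (p : ℝ) (hp : 1 ≤ p)
    (f : ℝ → ℝ)
    (hderiv : ∀ k < n, ∀ x ∈ Set.Icc a b,
      HasDerivAt (iteratedDeriv k f) (iteratedDeriv (k + 1) f x) x)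
    (hint : IntervalIntegrable (iteratedDeriv n f) volume a b)
    (x₀ : ℝ) (hx₀ : x₀ ∈ Set.Icc a b) :
    (∫ x in a..b,
        |f x - ((∑ k ∈ Finset.range n,
                  iteratedDeriv k f a * (x - a) ^ k / (Nat.factorial k : ℝ)) +
                iteratedDeriv n f x₀ * (x - a) ^ n / (Nat.factorial n : ℝ))| ^ p)
      ^ (1 / p) ≤
      ((b - a) ^ ((n : ℝ) - 1 + 1 / p) /
        ((Nat.factorial (n - 1) : ℝ) * (((n : ℝ) - 1) * p + 1) ^ (1 / p))) *
        ⨆ c : Set.Icc a b, |∫ t in a..(c : ℝ),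
          (iteratedDeriv n f t - iteratedDeriv n f x₀)| := by
  obtain ⟨m, rfl⟩ : ∃ m, n = m + 1 := ⟨n - 1, by lia⟩
  set C := iteratedDeriv (m + 1) f x₀
  have hftc (x : ℝ) (hx : x ∈ Set.Icc a b) :
      ∫ t in a..x, (iteratedDeriv (m + 1) f t - C) =
        iteratedDeriv m f x - (iteratedDeriv m f a + C * (x - a)) := by
    have hsub : Set.uIcc a x ⊆ Set.Icc a b := by
      rw [Set.uIcc_of_le hx.1]
      exact Set.Icc_subset_Icc_right hx.2
    have hintx : IntervalIntegrable (iteratedDeriv (m + 1) f) volume a x :=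
      hint.mono_set (by rwa [Set.uIcc_of_le hab.le])
    rw [intervalIntegral.integral_sub hintx intervalIntegrable_const,
      integral_eq_sub_of_hasDerivAt
        (fun y hy => hderiv m (by lia) y (hsub hy)) hintx,
      intervalIntegral.integral_const, smul_eq_mul]
    ring
  have hcont : ContinuousOn (fun x => ∫ t in a..x, (iteratedDeriv (m + 1) f t - C))
      (Set.Icc a b) := by
    have h : ContinuousOn (iteratedDeriv m f) (Set.Icc a b) := fun x hx =>
      (hderiv m (by lia) x hx).continuousAt.continuousWithinAt
    refine ContinuousOn.congr (h.sub ?_) hftc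
    fun_prop
  have hbdd : BddAbove (Set.range fun c : Set.Icc a b =>
      |∫ t in a..(c : ℝ), (iteratedDeriv (m + 1) f t - C)|) := by
    obtain ⟨K, hK⟩ := isCompact_Icc.exists_bound_of_continuousOn hcont
    exact ⟨K, by rintro _ ⟨c, rfl⟩; exact hK c c.2⟩
  have hpoint := abs_modifiedRemainder_le a b C
    (⨆ c : Set.Icc a b, |∫ t in a..(c : ℝ), (iteratedDeriv (m + 1) f t - C)|) m
    (fun k => iteratedDeriv k f) (fun k hk => hderiv k (by lia))
    (fun x hx => by rw [← hftc x hx]; exact le_ciSup hbdd ⟨x, hx⟩)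
  have hf : ContinuousOn f (Set.Icc a b) := fun x hx => by
    simpa using (hderiv 0 (by lia) x hx).continuousAt.continuousWithinAt
  simp only [iteratedDeriv_zero] at hpoint
  have hP : Continuous fun x => (∑ k ∈ Finset.range (m + 1),
      iteratedDeriv k f a * (x - a) ^ k / (Nat.factorial k : ℝ)) +
      C * (x - a) ^ (m + 1) / (Nat.factorial (m + 1) : ℝ) := by fun_prop
  have hmain := rpow_integral_abs_rpow_le a b hab m p hp _
    (Real.iSup_nonneg fun _ => abs_nonneg _) _ (hf.sub hP.continuousOn) hpoint
  simpa using hmain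
end

section
/- Let a < b be real numbers and n ≥ 1 a natural number. Suppose f : ℝ → ℝ is such that for each k ≤ n the k-th derivative f^{(k)} exists at every point of [a,b], and f^{(n)} is interval-integrable on [a,b]. Let x₀ ∈ [a,b]. Then sup_{a ≤ x ≤ b} |R_{n,x₀}(x)| ≤ ((b-a)^{n-1} / (n-1)!) · ‖f^{(n)}(·) - f^{(n)}(x₀)‖, where the Alexiewicz norm is taken over [a,b]. -/
open MeasureTheory intervalIntegral

/-- Termwise differentiation of a Taylor-type polynomial centred at `a`. -/
lemma hasDerivAt_sum_pow_div_factorial (a : ℝ) (d : ℕ → ℝ) (N : ℕ) (x : ℝ) :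
    HasDerivAt (fun y => ∑ k ∈ Finset.range (N + 1), d k * (y - a) ^ k / (Nat.factorial k : ℝ))
      (∑ k ∈ Finset.range N, d (k + 1) * (x - a) ^ k / (Nat.factorial k : ℝ)) x := by
  simp only [Finset.sum_range_succ' _ N]
  have key : ∀ k ∈ Finset.range N,
      HasDerivAt (fun y => d (k + 1) * (y - a) ^ (k + 1) / (Nat.factorial (k + 1) : ℝ))
        (d (k + 1) * (x - a) ^ k / (Nat.factorial k : ℝ)) x := by
    intro k _
    have h := ((((hasDerivAt_id x).sub_const a).pow (k + 1)).const_mul (d (k + 1))).div_const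
      (Nat.factorial (k + 1) : ℝ)
    refine h.congr_deriv ?_
    rw [Nat.factorial_succ]
    push_cast
    simp only [id]
    field_simp
  simpa using (HasDerivAt.fun_sum key).add_const (d 0)

/-- If `F 0, …, F (m + 1)` are successive derivatives on `[a, b]` and the first-order remainder of
`F m` with slope `c` is bounded by `M`, then the order `m + 1` remainder of `F 0` with leading
coefficient `c` is bounded by `M (x - a) ^ m / m!`. -/
lemma abs_modified_remainder_le {a b c M : ℝ} (m : ℕ) (F : ℕ → ℝ → ℝ)
    (hF : ∀ k ≤ m, ∀ x ∈ Set.Icc a b, HasDerivAt (F k) (F (k + 1) x) x)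
    (hM : ∀ x ∈ Set.Icc a b, |F m x - F m a - c * (x - a)| ≤ M) :
    ∀ x ∈ Set.Icc a b,
      |F 0 x - ((∑ k ∈ Finset.range (m + 1), F k a * (x - a) ^ k / (Nat.factorial k : ℝ)) +
        c * (x - a) ^ (m + 1) / (Nat.factorial (m + 1) : ℝ))| ≤
      M * (x - a) ^ m / (Nat.factorial m : ℝ) := by
  induction m generalizing F with
  | zero =>
    intro x hx
    simpa [sub_sub] using hM x hx
  | succ m ih =>
    have hbound := ih (fun k => F (k + 1)) (fun k hk => hF (k + 1) (by lia)) hM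
    have hpow : ∀ (N : ℕ) (C x : ℝ), HasDerivAt
        (fun y => C * (y - a) ^ (N + 1) / (Nat.factorial (N + 1) : ℝ))
        (C * (x - a) ^ N / (Nat.factorial N : ℝ)) x := by
      intro N C x
      have h := hasDerivAt_sum_pow_div_factorial a (Pi.single (N + 1) C) (N + 1) x
      simpa [Finset.sum_range_succ, Pi.single_apply, Finset.sum_ite_eq, ite_mul, ite_div] using h
    have hR : ∀ x ∈ Set.Icc a b, HasDerivAt
        (fun y => F 0 y -
          ((∑ k ∈ Finset.range (m + 1 + 1), F k a * (y - a) ^ k / (Nat.factorial k : ℝ)) +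
            c * (y - a) ^ (m + 1 + 1) / (Nat.factorial (m + 1 + 1) : ℝ)))
        (F 1 x -
          ((∑ k ∈ Finset.range (m + 1), F (k + 1) a * (x - a) ^ k / (Nat.factorial k : ℝ)) +
            c * (x - a) ^ (m + 1) / (Nat.factorial (m + 1) : ℝ))) x := fun x hx =>
      (hF 0 (Nat.zero_le _) x hx).sub
        ((hasDerivAt_sum_pow_div_factorial a (fun k => F k a) (m + 1) x).add (hpow (m + 1) c x))
    intro x hx
    exact image_norm_le_of_norm_deriv_right_le_deriv_boundary
      (fun y hy => (hR y hy).continuousAt.continuousWithinAt)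
      (fun y hy => (hR y (Set.Ico_subset_Icc_self hy)).hasDerivWithinAt)
      (by simp [Finset.sum_range_succ'])
      (fun y => hpow m M y)
      (fun y hy => hbound y (Set.Ico_subset_Icc_self hy)) hx

/-- Sup-norm estimate for the modified remainder `R_{n,x₀}` in terms of
the Alexiewicz norm of `f⁽ⁿ⁾(·) - f⁽ⁿ⁾(x₀)`. -/
theorem modified_remainder_sup_estimate
    (a b : ℝ) (hab : a < b) (n : ℕ) (hn : 1 ≤ n) (f : ℝ → ℝ)
    (hderiv : ∀ k < n, ∀ x ∈ Set.Icc a b,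
      HasDerivAt (iteratedDeriv k f) (iteratedDeriv (k + 1) f x) x)
    (hint : IntervalIntegrable (iteratedDeriv n f) volume a b)
    (x₀ : ℝ) (hx₀ : x₀ ∈ Set.Icc a b) :
    (⨆ x : Set.Icc a b,
        |f (x : ℝ) - ((∑ k ∈ Finset.range n,
            iteratedDeriv k f a * ((x : ℝ) - a) ^ k / (Nat.factorial k : ℝ)) +
          iteratedDeriv n f x₀ * ((x : ℝ) - a) ^ n / (Nat.factorial n : ℝ))|) ≤
      ((b - a) ^ (n - 1) / (Nat.factorial (n - 1) : ℝ)) *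
        ⨆ c : Set.Icc a b, |∫ t in a..(c : ℝ),
          (iteratedDeriv n f t - iteratedDeriv n f x₀)| := by
  obtain ⟨m, rfl⟩ : ∃ m, n = m + 1 := ⟨n - 1, by lia⟩
  rw [Nat.add_sub_cancel]
  set c := iteratedDeriv (m + 1) f x₀
  set M := ⨆ x : Set.Icc a b, |∫ t in a..(x : ℝ), (iteratedDeriv (m + 1) f t - c)|
  have hftc : ∀ x ∈ Set.Icc a b, ∫ t in a..x, (iteratedDeriv (m + 1) f t - c) =
      iteratedDeriv m f x - iteratedDeriv m f a - c * (x - a) := by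
    intro x hx
    have hsub : Set.uIcc a x ⊆ Set.Icc a b := by
      rw [Set.uIcc_of_le hx.1]
      exact Set.Icc_subset_Icc_right hx.2
    have hint' := hint.mono_set (hsub.trans Set.Icc_subset_uIcc)
    rw [integral_sub hint' (by simp), integral_eq_sub_of_hasDerivAt
      (fun y hy => hderiv m (Nat.lt_succ_self m) y (hsub hy)) hint', intervalIntegral.integral_const,
      smul_eq_mul]
    ring
  have hbdd : BddAbove (Set.range fun x : Set.Icc a b =>
      |∫ t in a..(x : ℝ), (iteratedDeriv (m + 1) f t - c)|) := by
    have hcont : ContinuousOn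
        (fun x => |iteratedDeriv m f x - iteratedDeriv m f a - c * (x - a)|) (Set.Icc a b) := by
      have : ContinuousOn (iteratedDeriv m f) (Set.Icc a b) := fun x hx =>
        (hderiv m (Nat.lt_succ_self m) x hx).continuousAt.continuousWithinAt
      fun_prop
    obtain ⟨C, hC⟩ := isCompact_Icc.bddAbove_image hcont
    refine ⟨C, ?_⟩
    rintro _ ⟨x, rfl⟩
    simp only [hftc x x.2]
    exact hC ⟨x, x.2, rfl⟩
  have hM : ∀ x ∈ Set.Icc a b,
      |iteratedDeriv m f x - iteratedDeriv m f a - c * (x - a)| ≤ M := by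
    intro x hx
    rw [← hftc x hx]
    exact le_ciSup hbdd ⟨x, hx⟩
  have hM0 : 0 ≤ M := Real.iSup_nonneg fun _ => abs_nonneg _
  have : Nonempty (Set.Icc a b) := ⟨⟨x₀, hx₀⟩⟩
  refine ciSup_le fun x => ?_
  have h := abs_modified_remainder_le m (fun k => iteratedDeriv k f)
    (fun k hk => hderiv k (by lia)) hM x x.2
  simp only [iteratedDeriv_zero] at h
  refine h.trans ?_
  rw [mul_comm, div_mul_eq_mul_div]
  have hx0 : 0 ≤ (x : ℝ) - a := sub_nonneg.2 x.2.1
  have hxb := x.2.2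
  gcongr
end

section
/- Let a < b be real numbers and n ≥ 1 a natural number. Suppose f : ℝ → ℝ is such that for each k ≤ n the k-th derivative f^{(k)} exists at every point of [a,b], and f^{(n)} is interval-integrable on [a,b]. Then ‖R_n‖ ≤ ((b-a)^n / n!) · ‖f^{(n)}(·) - f^{(n)}(a)‖, where both Alexiewicz norms are taken over [a,b]. (This is Young's expansion theorem with a precise error estimate.) -/
open MeasureTheory intervalIntegral

/-- The Taylor remainder of order `n + 1` of a chain of derivatives `D` has as its derivative the
Taylor remainder of order `n` of the shifted chain. -/
theorem hasDerivAt_taylorRemainder (D : ℕ → ℝ → ℝ) (n : ℕ) (a x : ℝ)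
    (h : HasDerivAt (D 0) (D 1 x) x) :
    HasDerivAt
      (fun y ↦ D 0 y - ∑ k ∈ Finset.range (n + 2), D k a * (y - a) ^ k / (Nat.factorial k : ℝ))
      (D 1 x - ∑ k ∈ Finset.range (n + 1), D (k + 1) a * (x - a) ^ k / (Nat.factorial k : ℝ))
      x := by
  refine h.sub ?_
  simp_rw [Finset.sum_range_succ' _ (n + 1)]
  simp only [pow_zero]
  refine HasDerivAt.add_const _ (HasDerivAt.fun_sum fun k _ ↦ ?_)
  refine (((((hasDerivAt_id' x).sub_const a).fun_pow (k + 1)).const_mul (D (k + 1) a)).div_const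
    (Nat.factorial (k + 1) : ℝ)).congr_deriv ?_
  have hk : (Nat.factorial k : ℝ) ≠ 0 := by positivity
  have hk' : (k : ℝ) + 1 ≠ 0 := by positivity
  simp only [Nat.factorial_succ, Nat.cast_mul, Nat.cast_add, Nat.cast_one, Nat.add_sub_cancel]
  field_simp

/-- If the primitive of `D n - D n a` is bounded by `M` on `[a, b]`, then the primitive of the
Taylor remainder of `D 0` is bounded by `M * (c - a) ^ n / n!`. -/
theorem abs_integral_taylorRemainder_le {a b M : ℝ} (n : ℕ) (D : ℕ → ℝ → ℝ)
    (hderiv : ∀ k < n, ∀ x ∈ Set.Icc a b, HasDerivAt (D k) (D (k + 1) x) x)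
    (hint : IntervalIntegrable (D n) volume a b)
    (hM : ∀ c ∈ Set.Icc a b, |∫ t in a..c, (D n t - D n a)| ≤ M) :
    ∀ c ∈ Set.Icc a b,
      |∫ x in a..c, (D 0 x - ∑ k ∈ Finset.range (n + 1),
        D k a * (x - a) ^ k / (Nat.factorial k : ℝ))| ≤
          M * ((c - a) ^ n / (Nat.factorial n : ℝ)) := by
  induction n generalizing D with
  | zero => simpa using hM
  | succ n ih =>
    have bound := ih (fun k ↦ D (k + 1)) (fun k hk ↦ hderiv (k + 1) (by lia)) hint hM
    intro c hc
    have hab : a ≤ b := hc.1.trans hc.2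
    have hint_one : IntervalIntegrable (D 1) volume a b := by
      cases n with
      | zero => exact hint
      | succ m =>
        refine ContinuousOn.intervalIntegrable_of_Icc hab fun x hx ↦ ?_
        exact (hderiv 1 (by lia) x hx).continuousAt.continuousWithinAt
    have pointwise : ∀ x ∈ Set.Icc a b,
        |D 0 x - ∑ k ∈ Finset.range (n + 2), D k a * (x - a) ^ k / (Nat.factorial k : ℝ)| ≤
          M * ((x - a) ^ n / (Nat.factorial n : ℝ)) := by
      intro x hx
      have sub : Set.uIcc a x ⊆ Set.Icc a b := by
        rw [Set.uIcc_of_le hx.1]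
        exact Set.Icc_subset_Icc_right hx.2
      have ftc := integral_eq_sub_of_hasDerivAt
        (fun y hy ↦ hasDerivAt_taylorRemainder D n a y (hderiv 0 (by lia) y (sub hy)))
        ((hint_one.mono_set (by rwa [Set.uIcc_of_le hab])).sub
          (Continuous.intervalIntegrable (by fun_prop) _ _))
      have at_a : D 0 a - ∑ k ∈ Finset.range (n + 2),
          D k a * (a - a) ^ k / (Nat.factorial k : ℝ) = 0 := by
        simp [Finset.sum_range_succ' _ (n + 1)]
      have hx' := bound x hx
      rw [at_a, sub_zero] at ftc
      rwa [← ftc]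
    have integral_bound : ∫ x in a..c, M * ((x - a) ^ n / (Nat.factorial n : ℝ)) =
        M * ((c - a) ^ (n + 1) / (Nat.factorial (n + 1) : ℝ)) := by
      rw [intervalIntegral.integral_const_mul, intervalIntegral.integral_div,
        integral_comp_sub_right (fun x ↦ x ^ n), integral_pow]
      simp [Nat.factorial_succ, div_div]
    rw [← integral_bound, ← Real.norm_eq_abs]
    refine norm_integral_le_of_norm_le hc.1 (ae_of_all _ fun x hx ↦ ?_)
      (Continuous.intervalIntegrable (by fun_prop) _ _)
    exact pointwise x ⟨hx.1.le, hx.2.trans hc.2⟩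

/-- Young's expansion theorem with a precise error estimate: Alexiewicz-norm
bound on the Taylor remainder `R_n` when `f⁽ⁿ⁾` is integrable. -/
theorem young_expansion_alexiewicz_estimate
    (a b : ℝ) (hab : a < b) (n : ℕ) (hn : 1 ≤ n) (f : ℝ → ℝ)
    (hderiv : ∀ k < n, ∀ x ∈ Set.Icc a b,
      HasDerivAt (iteratedDeriv k f) (iteratedDeriv (k + 1) f x) x)
    (hint : IntervalIntegrable (iteratedDeriv n f) volume a b) :
    (⨆ c : Set.Icc a b, |∫ x in a..(c : ℝ),
        (f x - ∑ k ∈ Finset.range (n + 1),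
          iteratedDeriv k f a * (x - a) ^ k / (Nat.factorial k : ℝ))|) ≤
      ((b - a) ^ n / (Nat.factorial n : ℝ)) *
        ⨆ c : Set.Icc a b, |∫ t in a..(c : ℝ),
          (iteratedDeriv n f t - iteratedDeriv n f a)| := by
  have bdd : BddAbove (Set.range fun c : Set.Icc a b ↦
      |∫ t in a..(c : ℝ), (iteratedDeriv n f t - iteratedDeriv n f a)|) := by
    have cont := continuousOn_primitive_interval'
      (hint.sub (intervalIntegrable_const (c := iteratedDeriv n f a))) Set.left_mem_uIcc
    rw [Set.uIcc_of_le hab.le] at cont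
    have := isCompact_Icc.bddAbove_image cont.abs
    rwa [Set.image_eq_range] at this
  have : Nonempty (Set.Icc a b) := ⟨⟨a, Set.left_mem_Icc.2 hab.le⟩⟩
  refine ciSup_le fun c ↦ ?_
  have key := abs_integral_taylorRemainder_le n (fun k ↦ iteratedDeriv k f) hderiv hint
    (fun c hc ↦ le_ciSup bdd ⟨c, hc⟩) c c.2
  simp only [iteratedDeriv_zero] at key
  rw [mul_comm]
  refine key.trans ?_
  have hc := c.2.1
  have hc' := c.2.2
  gcongr
  · exact Real.iSup_nonneg fun _ ↦ abs_nonneg _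
end

section
/- Let a < b be real numbers and n ≥ 1 a natural number. Suppose f : ℝ → ℝ is such that for each k ≤ n+1 the k-th derivative f^{(k)} exists at every point of [a,b], and f^{(n+1)} is interval-integrable on [a,b]. Then for all x ∈ [a,b], |R_n(x)| ≤ ((x-a)^n / n!) · ‖f^{(n+1)}‖_{[a,x]}. -/
open MeasureTheory intervalIntegral

/-- The derivative of `t ↦ c (t - a)^(k+1) / (k+1)!` is `t ↦ c (t - a)^k / k!`. -/
lemma hasDerivAt_mul_sub_pow_succ_div_factorial (a c y : ℝ) (k : ℕ) :
    HasDerivAt (fun t => c * (t - a) ^ (k + 1) / (Nat.factorial (k + 1) : ℝ))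
      (c * (y - a) ^ k / (Nat.factorial k : ℝ)) y := by
  have h := (((((hasDerivAt_id y).sub_const a).pow (k + 1)).const_mul c).div_const
    (Nat.factorial (k + 1) : ℝ))
  refine h.congr_deriv ?_
  have hk : (Nat.factorial k : ℝ) ≠ 0 := by positivity
  have hk' : (k : ℝ) + 1 ≠ 0 := by positivity
  simp only [id_eq, Nat.factorial_succ, Nat.cast_mul, Nat.cast_add, Nat.cast_one,
    Nat.add_sub_cancel]
  field_simp

/-- If each `F k` with `k < n` has derivative `F (k + 1)` on `[a, x]`, and `F n` stays within `M`
of its value at `a`, then the Taylor remainder of `F 0` of order `n` at `a` is at most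
`M (y - a)^n / n!`. -/
lemma abs_sub_taylor_sum_le {a x M : ℝ} (n : ℕ) (F : ℕ → ℝ → ℝ)
    (hF : ∀ k < n, ∀ y ∈ Set.Icc a x, HasDerivAt (F k) (F (k + 1) y) y)
    (hM : ∀ y ∈ Set.Icc a x, |F n y - F n a| ≤ M) :
    ∀ y ∈ Set.Icc a x,
      |F 0 y - ∑ k ∈ Finset.range (n + 1), F k a * (y - a) ^ k / (Nat.factorial k : ℝ)| ≤
        M * (y - a) ^ n / (Nat.factorial n : ℝ) := by
  induction n generalizing F with
  | zero => simpa using hM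
  | succ n ih =>
    have hrem := ih (fun k => F (k + 1)) (fun k hk => hF (k + 1) (by lia)) hM
    have hderiv : ∀ y ∈ Set.Icc a x, HasDerivAt
        (fun t => F 0 t - ∑ k ∈ Finset.range (n + 1 + 1),
          F k a * (t - a) ^ k / (Nat.factorial k : ℝ))
        (F 1 y - ∑ k ∈ Finset.range (n + 1),
          F (k + 1) a * (y - a) ^ k / (Nat.factorial k : ℝ)) y := by
      intro y hy
      simp only [Finset.sum_range_succ' _ (n + 1), pow_zero]
      exact (hF 0 (by lia) y hy).sub ((HasDerivAt.fun_sum fun k _ =>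
        hasDerivAt_mul_sub_pow_succ_div_factorial a (F (k + 1) a) y k).add_const _)
    refine fun y hy => image_norm_le_of_norm_deriv_right_le_deriv_boundary
      (fun y hy => (hderiv y hy).continuousAt.continuousWithinAt)
      (fun y hy => (hderiv y (Set.Ico_subset_Icc_self hy)).hasDerivWithinAt) ?_
      (fun y => hasDerivAt_mul_sub_pow_succ_div_factorial a M y n)
      (fun y hy => hrem y (Set.Ico_subset_Icc_self hy)) hy
    simp [Finset.sum_range_succ' _ (n + 1)]

/-- Pointwise estimate of the Taylor remainder `R_n` via the Alexiewicz
norm of `f⁽ⁿ⁺¹⁾` on `[a,x]`. -/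
theorem taylor_remainder_pointwise_estimate
    (a b : ℝ) (hab : a < b) (n : ℕ) (hn : 1 ≤ n) (f : ℝ → ℝ)
    (hderiv : ∀ k < n + 1, ∀ x ∈ Set.Icc a b,
      HasDerivAt (iteratedDeriv k f) (iteratedDeriv (k + 1) f x) x)
    (hint : IntervalIntegrable (iteratedDeriv (n + 1) f) volume a b) :
    ∀ x ∈ Set.Icc a b,
      |f x - ∑ k ∈ Finset.range (n + 1),
          iteratedDeriv k f a * (x - a) ^ k / (Nat.factorial k : ℝ)| ≤
        ((x - a) ^ n / (Nat.factorial n : ℝ)) *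
          ⨆ c : Set.Icc a x, |∫ t in a..(c : ℝ), iteratedDeriv (n + 1) f t| := by
  intro x hx
  have hsub : Set.Icc a x ⊆ Set.Icc a b := Set.Icc_subset_Icc_right hx.2
  have hftc : ∀ y ∈ Set.Icc a x,
      ∫ t in a..y, iteratedDeriv (n + 1) f t = iteratedDeriv n f y - iteratedDeriv n f a := by
    intro y hy
    have huIcc : Set.uIcc a y ⊆ Set.Icc a b := by
      rw [Set.uIcc_of_le hy.1]
      exact Set.Icc_subset_Icc_right (hsub hy).2
    refine integral_eq_sub_of_hasDerivAt (fun t ht => hderiv n n.lt_succ_self t (huIcc ht))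
      (hint.mono_set ?_)
    rwa [Set.uIcc_of_le hab.le]
  have hcont : ContinuousOn (fun y => |iteratedDeriv n f y - iteratedDeriv n f a|)
      (Set.Icc a x) := fun y hy =>
    ((hderiv n n.lt_succ_self y (hsub hy)).continuousAt.sub
      continuousAt_const).abs.continuousWithinAt
  have hbdd : BddAbove (Set.range fun c : Set.Icc a x =>
      |∫ t in a..(c : ℝ), iteratedDeriv (n + 1) f t|) := by
    obtain ⟨C, hC⟩ := isCompact_Icc.bddAbove_image hcont
    refine ⟨C, ?_⟩
    rintro _ ⟨c, rfl⟩
    simp only [hftc c c.2]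
    exact hC (Set.mem_image_of_mem _ c.2)
  have h := abs_sub_taylor_sum_le n (fun k => iteratedDeriv k f)
    (fun k hk y hy => hderiv k (by lia) y (hsub hy))
    (fun y hy => (hftc y hy) ▸ le_ciSup hbdd ⟨y, hy⟩) x ⟨hx.1, le_rfl⟩
  simp only [iteratedDeriv_zero] at h
  rwa [div_mul_eq_mul_div, mul_comm ((x - a) ^ n)]
end

section
/- Let a < b be real numbers and n ≥ 1 a natural number. Suppose f : ℝ → ℝ is such that for each k ≤ n+1 the k-th derivative f^{(k)} exists at every point of [a,b], and f^{(n+1)} is interval-integrable on [a,b]. Then sup_{a ≤ x ≤ b} |R_n(x)| ≤ ((b-a)^n / n!) · ‖f^{(n+1)}‖, where the Alexiewicz norm is taken over [a,b]. -/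
open MeasureTheory intervalIntegral

/-- The polynomial with Taylor coefficients `c` at `a` is differentiated by shifting `c`. -/
lemma hasDerivAt_sum_taylor_coeff (c : ℕ → ℝ) (a : ℝ) (n : ℕ) (x : ℝ) :
    HasDerivAt (fun y => ∑ k ∈ Finset.range (n + 1), c k * (y - a) ^ k / (Nat.factorial k : ℝ))
      (∑ k ∈ Finset.range n, c (k + 1) * (x - a) ^ k / (Nat.factorial k : ℝ)) x := by
  simp only [Finset.sum_range_succ']
  have h : ∀ k ∈ Finset.range n,
      HasDerivAt (fun y => c (k + 1) * (y - a) ^ (k + 1) / (Nat.factorial (k + 1) : ℝ))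
        (c (k + 1) * (x - a) ^ k / (Nat.factorial k : ℝ)) x := by
    intro k _
    have := ((((hasDerivAt_id x).sub_const a).pow (k + 1)).const_mul (c (k + 1))).div_const
      (Nat.factorial (k + 1) : ℝ)
    refine this.congr_deriv ?_
    have : (Nat.factorial k : ℝ) ≠ 0 := by positivity
    simp only [Nat.factorial_succ, id, Nat.add_sub_cancel]
    push_cast
    field_simp
  simpa using (HasDerivAt.fun_sum h).add_const (c 0)

/-- If `F 0, …, F n` is a chain of successive derivatives on `[a, b]` and the oscillation
`|F n x - F n a|` is at most `M`, then the Taylor remainder of `F 0` is at most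
`M * (x - a) ^ n / n!`. -/
lemma abs_taylor_remainder_le_of_abs_sub_le {a b M : ℝ} (n : ℕ) (F : ℕ → ℝ → ℝ)
    (hF : ∀ k < n, ∀ x ∈ Set.Icc a b, HasDerivAt (F k) (F (k + 1) x) x)
    (hM : ∀ x ∈ Set.Icc a b, |F n x - F n a| ≤ M) :
    ∀ x ∈ Set.Icc a b,
      |F 0 x - ∑ k ∈ Finset.range (n + 1), F k a * (x - a) ^ k / (Nat.factorial k : ℝ)| ≤
        M * (x - a) ^ n / (Nat.factorial n : ℝ) := by
  induction n generalizing F with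
  | zero => simpa using hM
  | succ n ih =>
    have hbound := ih (fun k => F (k + 1)) (fun k hk => hF (k + 1) (by lia)) hM
    have hderiv : ∀ x ∈ Set.Icc a b, HasDerivAt
        (fun y => F 0 y - ∑ k ∈ Finset.range (n + 1 + 1),
          F k a * (y - a) ^ k / (Nat.factorial k : ℝ))
        (F 1 x - ∑ k ∈ Finset.range (n + 1),
          F (k + 1) a * (x - a) ^ k / (Nat.factorial k : ℝ)) x := fun x hx =>
      (hF 0 (by lia) x hx).sub (hasDerivAt_sum_taylor_coeff (fun k => F k a) a (n + 1) x)
    have hB : ∀ x, HasDerivAt (fun y => M * (y - a) ^ (n + 1) / (Nat.factorial (n + 1) : ℝ))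
        (M * (x - a) ^ n / (Nat.factorial n : ℝ)) x := by
      intro x
      have := ((((hasDerivAt_id x).sub_const a).pow (n + 1)).const_mul M).div_const
        (Nat.factorial (n + 1) : ℝ)
      refine this.congr_deriv ?_
      have : (Nat.factorial n : ℝ) ≠ 0 := by positivity
      simp only [Nat.factorial_succ, id, Nat.add_sub_cancel]
      push_cast
      field_simp
    intro x hx
    refine image_norm_le_of_norm_deriv_right_le_deriv_boundary
      (fun y hy => (hderiv y hy).continuousAt.continuousWithinAt)
      (fun y hy => (hderiv y (Set.Ico_subset_Icc_self hy)).hasDerivWithinAt) ?_ hB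
      (fun y hy => hbound y (Set.Ico_subset_Icc_self hy)) hx
    simp [Finset.sum_range_succ']

/-- Sup-norm estimate of the Taylor remainder `R_n` in terms of the
Alexiewicz norm of `f⁽ⁿ⁺¹⁾`. -/
theorem taylor_remainder_sup_estimate
    (a b : ℝ) (hab : a < b) (n : ℕ) (hn : 1 ≤ n) (f : ℝ → ℝ)
    (hderiv : ∀ k < n + 1, ∀ x ∈ Set.Icc a b,
      HasDerivAt (iteratedDeriv k f) (iteratedDeriv (k + 1) f x) x)
    (hint : IntervalIntegrable (iteratedDeriv (n + 1) f) volume a b) :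
    (⨆ x : Set.Icc a b,
        |f (x : ℝ) - ∑ k ∈ Finset.range (n + 1),
          iteratedDeriv k f a * ((x : ℝ) - a) ^ k / (Nat.factorial k : ℝ)|) ≤
      ((b - a) ^ n / (Nat.factorial n : ℝ)) *
        ⨆ c : Set.Icc a b, |∫ t in a..(c : ℝ), iteratedDeriv (n + 1) f t| := by
  have hFTC : ∀ x ∈ Set.Icc a b,
      ∫ t in a..x, iteratedDeriv (n + 1) f t = iteratedDeriv n f x - iteratedDeriv n f a := by
    intro x hx
    have hsub : Set.uIcc a x ⊆ Set.Icc a b := by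
      rw [Set.uIcc_of_le hx.1]
      exact Set.Icc_subset_Icc_right hx.2
    refine integral_eq_sub_of_hasDerivAt (fun t ht => hderiv n (by lia) t (hsub ht))
      (hint.mono_set ?_)
    rwa [Set.uIcc_of_le hab.le]
  have hbdd : BddAbove (Set.range fun c : Set.Icc a b =>
      |∫ t in a..(c : ℝ), iteratedDeriv (n + 1) f t|) := by
    have hcont : ContinuousOn (fun x => |iteratedDeriv n f x - iteratedDeriv n f a|)
        (Set.Icc a b) := fun x hx =>
      ((hderiv n (by lia) x hx).continuousAt.sub continuousAt_const).abs.continuousWithinAt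
    refine (isCompact_Icc.bddAbove_image hcont).mono ?_
    rintro _ ⟨c, rfl⟩
    exact ⟨c, c.2, by simp only [hFTC c c.2]⟩
  set M := ⨆ c : Set.Icc a b, |∫ t in a..(c : ℝ), iteratedDeriv (n + 1) f t|
  have hM : ∀ x ∈ Set.Icc a b, |iteratedDeriv n f x - iteratedDeriv n f a| ≤ M := by
    intro x hx
    rw [← hFTC x hx]
    exact le_ciSup hbdd ⟨x, hx⟩
  have hM0 : 0 ≤ M := (abs_nonneg _).trans (hM a (Set.left_mem_Icc.2 hab.le))
  have : Nonempty (Set.Icc a b) := ⟨⟨a, Set.left_mem_Icc.2 hab.le⟩⟩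
  refine ciSup_le fun x => ?_
  have hx := abs_taylor_remainder_le_of_abs_sub_le n (fun k => iteratedDeriv k f)
    (fun k hk => hderiv k (by lia)) hM x x.2
  simp only [iteratedDeriv_zero] at hx
  have hxa : 0 ≤ (x : ℝ) - a := sub_nonneg.2 x.2.1
  have hxb : (x : ℝ) ≤ b := x.2.2
  calc _ ≤ M * ((x : ℝ) - a) ^ n / (Nat.factorial n : ℝ) := hx
    _ ≤ M * (b - a) ^ n / (Nat.factorial n : ℝ) := by gcongr
    _ = _ := by ring
end

section
/- Let a < b be real numbers, n ≥ 1 a natural number, and 1 ≤ p < ∞ a real number. Suppose f : ℝ → ℝ is such that for each k ≤ n the k-th derivative f^{(k)} exists at every point of [a,b], and f^{(n)} is interval-integrable on [a,b]. Then ‖R_n‖_p ≤ ((b-a)^{n+1/p} / (n! · (np+1)^{1/p})) · |f^{(n)}(a)| + ((b-a)^{n-1+1/p} / ((n-1)! · ((n-1)p+1)^{1/p})) · ‖f^{(n)}‖, where the Alexiewicz norm ‖f^{(n)}‖ is taken over [a,b]. -/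
open MeasureTheory intervalIntegral

/-- If `f⁽ᵐ⁾` deviates from `f⁽ᵐ⁾(a)` by at most `M` on `[a, b]`, then the `m`-th Taylor remainder
of `f` about `a` is bounded by `M (x - a)ᵐ / m!` there. -/
theorem abs_sub_taylorSum_le_of_abs_iteratedDeriv_sub_le {a b M : ℝ} (m : ℕ) (f : ℝ → ℝ)
    (hderiv : ∀ k < m, ∀ x ∈ Set.Icc a b,
      HasDerivAt (iteratedDeriv k f) (iteratedDeriv (k + 1) f x) x)
    (hM : ∀ x ∈ Set.Icc a b, |iteratedDeriv m f x - iteratedDeriv m f a| ≤ M) :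
    ∀ x ∈ Set.Icc a b,
      |f x - ∑ k ∈ Finset.range (m + 1),
        iteratedDeriv k f a * (x - a) ^ k / (Nat.factorial k : ℝ)| ≤
        M * (x - a) ^ m / (Nat.factorial m : ℝ) := by
  induction m generalizing f with
  | zero => simpa using hM
  | succ m ih =>
    have ih' := ih (deriv f)
      (fun k hk x hx => by
        simpa only [iteratedDeriv_succ'] using hderiv (k + 1) (by omega) x hx)
      (fun x hx => by simpa only [iteratedDeriv_succ'] using hM x hx)
    have hf : ∀ x ∈ Set.Icc a b, HasDerivAt f (deriv f x) x := fun x hx => by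
      simpa using hderiv 0 (by omega) x hx
    have hpow : ∀ (k : ℕ) (c x : ℝ),
        HasDerivAt (fun y => c * (y - a) ^ (k + 1) / (Nat.factorial (k + 1) : ℝ))
          (c * (x - a) ^ k / (Nat.factorial k : ℝ)) x := fun k c x => by
      have h := ((((hasDerivAt_id x).sub_const a).pow (k + 1)).const_mul c).div_const
        (Nat.factorial (k + 1) : ℝ)
      refine h.congr_deriv ?_
      have h1 : (Nat.factorial k : ℝ) ≠ 0 := by positivity
      simp only [id, Nat.factorial_succ, Nat.add_sub_cancel]
      push_cast
      field_simp
    have hR : ∀ x ∈ Set.Icc a b, HasDerivAt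
        (fun y => f y - ∑ k ∈ Finset.range (m + 1 + 1),
          iteratedDeriv k f a * (y - a) ^ k / (Nat.factorial k : ℝ))
        (deriv f x - ∑ k ∈ Finset.range (m + 1),
          iteratedDeriv k (deriv f) a * (x - a) ^ k / (Nat.factorial k : ℝ)) x := by
      intro x hx
      refine (hf x hx).fun_sub ?_
      simp only [Finset.sum_range_succ' _ (m + 1), pow_zero, iteratedDeriv_succ']
      exact (HasDerivAt.fun_sum fun k _ => hpow k _ x).add_const _
    intro x hx
    refine image_norm_le_of_norm_deriv_right_le_deriv_boundary
      (B := fun y => M * (y - a) ^ (m + 1) / (Nat.factorial (m + 1) : ℝ))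
      (fun y hy => (hR y hy).continuousAt.continuousWithinAt)
      (fun y hy => (hR y (Set.Ico_subset_Icc_self hy)).hasDerivWithinAt) ?_
      (hpow m M) (fun y hy => ih' y (Set.Ico_subset_Icc_self hy)) hx
    simp [Finset.sum_range_succ']

/-- Minkowski's inequality for nonnegative continuous functions on a compact interval. -/
theorem intervalIntegral_Lp_add_le {a b p : ℝ} (hab : a ≤ b) (hp : 1 ≤ p) {u v : ℝ → ℝ}
    (hu : Continuous u) (hv : Continuous v) (hu0 : ∀ x ∈ Set.Icc a b, 0 ≤ u x)
    (hv0 : ∀ x ∈ Set.Icc a b, 0 ≤ v x) :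
    (∫ x in a..b, (u x + v x) ^ p) ^ (1 / p) ≤
      (∫ x in a..b, u x ^ p) ^ (1 / p) + (∫ x in a..b, v x ^ p) ^ (1 / p) := by
  have hp0 : 0 < p := by linarith
  have hq0 : ENNReal.ofReal p ≠ 0 := by simpa using hp0
  have hq : (ENNReal.ofReal p).toReal = p := ENNReal.toReal_ofReal hp0.le
  have memLp : ∀ w : ℝ → ℝ, Continuous w →
      MemLp w (ENNReal.ofReal p) (volume.restrict (Set.Ioc a b)) := fun w hw => by
    obtain ⟨C, hC⟩ := isCompact_Icc.exists_bound_of_continuousOn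
      (hw.continuousOn (s := Set.Icc a b))
    refine MemLp.of_bound hw.aestronglyMeasurable C ?_
    exact ae_restrict_of_forall_mem measurableSet_Ioc
      fun x hx => hC x (Set.Ioc_subset_Icc_self hx)
  have norm_eq : ∀ w : ℝ → ℝ, Continuous w → (∀ x ∈ Set.Icc a b, 0 ≤ w x) →
      eLpNorm w (ENNReal.ofReal p) (volume.restrict (Set.Ioc a b)) =
        ENNReal.ofReal ((∫ x in a..b, w x ^ p) ^ (1 / p)) := fun w hw hw0 => by
    rw [(memLp w hw).eLpNorm_eq_integral_rpow_norm hq0 ENNReal.ofReal_ne_top, hq,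
      integral_of_le hab, one_div]
    congr 2
    refine setIntegral_congr_fun measurableSet_Ioc fun x hx => ?_
    simp only [Real.norm_of_nonneg (hw0 x (Set.Ioc_subset_Icc_self hx))]
  have nonneg : ∀ w : ℝ → ℝ, (∀ x ∈ Set.Icc a b, 0 ≤ w x) →
      0 ≤ (∫ x in a..b, w x ^ p) ^ (1 / p) := fun w hw0 =>
    Real.rpow_nonneg (integral_nonneg hab fun x hx => Real.rpow_nonneg (hw0 x hx) _) _
  have h := eLpNorm_add_le (μ := volume.restrict (Set.Ioc a b)) (p := ENNReal.ofReal p)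
    hu.aestronglyMeasurable hv.aestronglyMeasurable (by simpa using hp)
  rw [norm_eq u hu hu0, norm_eq v hv hv0, norm_eq (u + v) (hu.add hv)
    (fun x hx => add_nonneg (hu0 x hx) (hv0 x hx)),
    ← ENNReal.ofReal_add (nonneg u hu0) (nonneg v hv0)] at h
  exact (ENNReal.ofReal_le_ofReal_iff (add_nonneg (nonneg u hu0) (nonneg v hv0))).1 h

/-- The `L^p` norm over `[a, b]` of the monomial `c (x - a) ^ k`. -/
theorem intervalIntegral_Lp_const_mul_sub_pow {a b p c : ℝ} (hab : a < b) (hp : 1 ≤ p)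
    (hc : 0 ≤ c) (k : ℕ) :
    (∫ x in a..b, (c * (x - a) ^ k) ^ p) ^ (1 / p) =
      c * ((b - a) ^ ((k : ℝ) + 1 / p) / ((k : ℝ) * p + 1) ^ (1 / p)) := by
  have hp0 : 0 < p := by linarith
  have hkp : 0 < (k : ℝ) * p + 1 := by positivity
  have hba : 0 < b - a := sub_pos.2 hab
  have hcongr : ∫ x in a..b, (c * (x - a) ^ k) ^ p =
      ∫ x in a..b, c ^ p * (x - a) ^ ((k : ℝ) * p) := by
    refine integral_congr fun x hx => ?_
    rw [Set.uIcc_of_le hab.le] at hx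
    have hx0 : 0 ≤ x - a := sub_nonneg.2 hx.1
    simp only [Real.mul_rpow hc (pow_nonneg hx0 k), Real.rpow_mul hx0, Real.rpow_natCast]
  rw [hcongr, intervalIntegral.integral_const_mul,
    integral_comp_sub_right (fun y => y ^ ((k : ℝ) * p)) a,
    integral_rpow (Or.inl (by nlinarith)), sub_self, Real.zero_rpow hkp.ne', sub_zero,
    Real.mul_rpow (by positivity) (by positivity), Real.div_rpow (by positivity) hkp.le,
    ← Real.rpow_mul hc, ← Real.rpow_mul hba.le, mul_one_div_cancel hp0.ne', Real.rpow_one]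
  congr 3
  field_simp

/-- `L^p` estimate of the Taylor remainder (the `A₁` bound, `n ≥ 1`):
`‖R_n‖_p` bounded using `|f⁽ⁿ⁾(a)|` and the Alexiewicz norm of `f⁽ⁿ⁾`. -/
theorem taylor_remainder_Lp_A1_estimate
    (a b : ℝ) (hab : a < b) (n : ℕ) (hn : 1 ≤ n) (p : ℝ) (hp : 1 ≤ p)
    (f : ℝ → ℝ)
    (hderiv : ∀ k < n, ∀ x ∈ Set.Icc a b,
      HasDerivAt (iteratedDeriv k f) (iteratedDeriv (k + 1) f x) x)
    (hint : IntervalIntegrable (iteratedDeriv n f) volume a b) :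
    (∫ x in a..b,
        |f x - ∑ k ∈ Finset.range (n + 1),
          iteratedDeriv k f a * (x - a) ^ k / (Nat.factorial k : ℝ)| ^ p)
      ^ (1 / p) ≤
      ((b - a) ^ ((n : ℝ) + 1 / p) /
        ((Nat.factorial n : ℝ) * ((n : ℝ) * p + 1) ^ (1 / p))) *
          |iteratedDeriv n f a| +
      ((b - a) ^ ((n : ℝ) - 1 + 1 / p) /
        ((Nat.factorial (n - 1) : ℝ) * (((n : ℝ) - 1) * p + 1) ^ (1 / p))) *
        ⨆ c : Set.Icc a b, |∫ t in a..(c : ℝ), iteratedDeriv n f t| := by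
  obtain ⟨m, rfl⟩ : ∃ m, n = m + 1 := ⟨n - 1, by omega⟩
  have hp0 : 0 < p := by linarith
  set M := ⨆ c : Set.Icc a b, |∫ t in a..(c : ℝ), iteratedDeriv (m + 1) f t|
  have hM0 : 0 ≤ M := Real.iSup_nonneg fun _ => abs_nonneg _
  have hFTC : ∀ x ∈ Set.Icc a b, ∫ t in a..x, iteratedDeriv (m + 1) f t =
      iteratedDeriv m f x - iteratedDeriv m f a := fun x hx => by
    have hsub : Set.uIcc a x ⊆ Set.uIcc a b := by
      rw [Set.uIcc_of_le hx.1, Set.uIcc_of_le hab.le]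
      exact Set.Icc_subset_Icc_right hx.2
    refine integral_eq_sub_of_hasDerivAt (fun y hy => hderiv m (by omega) y ?_)
      (hint.mono_set hsub)
    simpa only [Set.uIcc_of_le hab.le] using hsub hy
  have hbdd : BddAbove (Set.range fun c : Set.Icc a b =>
      |∫ t in a..(c : ℝ), iteratedDeriv (m + 1) f t|) := by
    have hcont : ContinuousOn (fun x => iteratedDeriv m f x - iteratedDeriv m f a)
        (Set.Icc a b) := fun x hx =>
      ((hderiv m (by omega) x hx).continuousAt.sub continuousAt_const).continuousWithinAt
    obtain ⟨C, hC⟩ := isCompact_Icc.exists_bound_of_continuousOn hcont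
    refine ⟨C, ?_⟩
    rintro _ ⟨c, rfl⟩
    simpa only [hFTC c c.2, Real.norm_eq_abs] using hC c c.2
  have hM : ∀ x ∈ Set.Icc a b, |iteratedDeriv m f x - iteratedDeriv m f a| ≤ M :=
    fun x hx => by
      rw [← hFTC x hx]
      exact le_ciSup hbdd ⟨x, hx⟩
  have hrem := abs_sub_taylorSum_le_of_abs_iteratedDeriv_sub_le m f
    (fun k hk => hderiv k (by omega)) hM
  set A := |iteratedDeriv (m + 1) f a| / (Nat.factorial (m + 1) : ℝ) with hA
  set B := M / (Nat.factorial m : ℝ) with hB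
  have hA0 : 0 ≤ A := by positivity
  have hB0 : 0 ≤ B := by positivity
  have hbound : ∀ x ∈ Set.Icc a b,
      |f x - ∑ k ∈ Finset.range (m + 1 + 1),
        iteratedDeriv k f a * (x - a) ^ k / (Nat.factorial k : ℝ)| ≤
        A * (x - a) ^ (m + 1) + B * (x - a) ^ m := fun x hx => by
    have hx0 : 0 ≤ x - a := sub_nonneg.2 hx.1
    rw [Finset.sum_range_succ, ← sub_sub, add_comm (A * _)]
    refine (abs_sub _ _).trans (add_le_add ((hrem x hx).trans_eq ?_) (le_of_eq ?_))
    · rw [hB]; ring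
    · rw [abs_div, abs_mul, abs_of_nonneg (pow_nonneg hx0 _), Nat.abs_cast, hA]; ring
  have hmono : ∫ x in a..b, |f x - ∑ k ∈ Finset.range (m + 1 + 1),
        iteratedDeriv k f a * (x - a) ^ k / (Nat.factorial k : ℝ)| ^ p ≤
      ∫ x in a..b, (A * (x - a) ^ (m + 1) + B * (x - a) ^ m) ^ p := by
    rw [integral_of_le hab.le, integral_of_le hab.le]
    refine integral_mono_of_nonneg (ae_of_all _ fun x => by positivity) ?_ ?_
    · refine Continuous.integrableOn_Ioc (Continuous.rpow_const (by fun_prop) ?_)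
      exact fun _ => Or.inr hp0.le
    · exact ae_restrict_of_forall_mem measurableSet_Ioc fun x hx =>
        Real.rpow_le_rpow (abs_nonneg _) (hbound x (Set.Ioc_subset_Icc_self hx)) hp0.le
  calc _ ≤ (∫ x in a..b, (A * (x - a) ^ (m + 1) + B * (x - a) ^ m) ^ p) ^ (1 / p) :=
        Real.rpow_le_rpow (integral_nonneg hab.le fun x _ => by positivity) hmono
          (by positivity)
    _ ≤ (∫ x in a..b, (A * (x - a) ^ (m + 1)) ^ p) ^ (1 / p) +
        (∫ x in a..b, (B * (x - a) ^ m) ^ p) ^ (1 / p) :=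
      intervalIntegral_Lp_add_le hab.le hp (by fun_prop) (by fun_prop)
        (fun x hx => mul_nonneg hA0 (pow_nonneg (sub_nonneg.2 hx.1) _))
        (fun x hx => mul_nonneg hB0 (pow_nonneg (sub_nonneg.2 hx.1) _))
    _ = _ := by
      rw [intervalIntegral_Lp_const_mul_sub_pow hab hp hA0,
        intervalIntegral_Lp_const_mul_sub_pow hab hp hB0, hA, hB, Nat.add_sub_cancel]
      push_cast
      rw [add_sub_cancel_right]
      congr 1 <;> ring
end

section
/- Let a < b be real numbers, n ≥ 1 a natural number, 1 ≤ p < ∞ a real number, and 1 < α < ∞ with conjugate exponent β satisfying 1/α + 1/β = 1. Suppose f : ℝ → ℝ is such that for each k ≤ n the k-th derivative f^{(k)} exists at every point of [a,b], f^{(n)} is interval-integrable on [a,b], and ‖f^{(n)}‖_α = (∫_a^b |f^{(n)}(t)|^α dt)^{1/α} is finite. Then ‖R_n‖_p ≤ ((b-a)^{n+1/p} / (n! · (np+1)^{1/p})) · |f^{(n)}(a)| + ((b-a)^{n-1+1/p+1/β} / ((n-1)! · ((n-1)β+1)^{1/β} · ((n-1+1/β)p+1)^{1/p})) · ‖f^{(n)}‖_α.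 -/
open MeasureTheory intervalIntegral

/-- The `L^q` norm of `u ↦ u ^ r` on `[0, d]`. -/
lemma integral_rpow_rpow_rpow_one_div {d r q : ℝ} (hd : 0 ≤ d) (hr : 0 ≤ r) (hq : 0 < q) :
    (∫ u in (0 : ℝ)..d, (u ^ r) ^ q) ^ (1 / q) =
      d ^ (r + 1 / q) / (r * q + 1) ^ (1 / q) := by
  have hrq : 0 ≤ r * q := by positivity
  have hcongr : ∫ u in (0 : ℝ)..d, (u ^ r) ^ q = ∫ u in (0 : ℝ)..d, u ^ (r * q) := by
    refine integral_congr fun u hu => ?_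
    rw [Set.uIcc_of_le hd] at hu
    exact (Real.rpow_mul hu.1 r q).symm
  rw [hcongr, integral_rpow (Or.inl (by linarith)), Real.zero_rpow (by linarith), sub_zero,
    Real.div_rpow (Real.rpow_nonneg hd _) (by linarith), ← Real.rpow_mul hd]
  congr 2
  field_simp

/-- The Taylor sum, as a function of its centre, has a single-term derivative. -/
lemma hasDerivAt_sum_iteratedDeriv_mul_sub_pow {f : ℝ → ℝ} {t : ℝ} (x : ℝ) (m : ℕ)
    (h : ∀ k ≤ m, HasDerivAt (iteratedDeriv k f) (iteratedDeriv (k + 1) f t) t) :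
    HasDerivAt (fun s => ∑ k ∈ Finset.range (m + 1),
        iteratedDeriv k f s * (x - s) ^ k / (k.factorial : ℝ))
      ((x - t) ^ m * iteratedDeriv (m + 1) f t / (m.factorial : ℝ)) t := by
  induction m with
  | zero => simpa using h 0 le_rfl
  | succ m ih =>
    simp_rw [Finset.sum_range_succ _ (m + 1)]
    have hpow : HasDerivAt (fun s => (x - s) ^ (m + 1)) (((m + 1 : ℕ) : ℝ) * (x - t) ^ m * -1) t :=
      ((hasDerivAt_id t).const_sub x).pow (m + 1)
    refine ((ih fun k hk => h k (by omega)).add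
      (((h (m + 1) le_rfl).mul hpow).div_const ((m + 1).factorial : ℝ))).congr_deriv ?_
    rw [Nat.factorial_succ]
    have : (m.factorial : ℝ) ≠ 0 := by positivity
    push_cast
    field_simp
    ring

/-- Taylor's formula with integral remainder, when the top derivative is merely integrable. -/
lemma sub_sum_iteratedDeriv_eq_integral {f : ℝ → ℝ} {a x : ℝ} (hax : a ≤ x) (m : ℕ)
    (hderiv : ∀ k ≤ m, ∀ t ∈ Set.Icc a x,
      HasDerivAt (iteratedDeriv k f) (iteratedDeriv (k + 1) f t) t)
    (hint : IntervalIntegrable (iteratedDeriv (m + 1) f) volume a x) :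
    f x - ∑ k ∈ Finset.range (m + 1), iteratedDeriv k f a * (x - a) ^ k / (k.factorial : ℝ) =
      (∫ t in a..x, (x - t) ^ m * iteratedDeriv (m + 1) f t) / (m.factorial : ℝ) := by
  rw [← intervalIntegral.integral_div, integral_eq_sub_of_hasDerivAt
    (f := fun s => ∑ k ∈ Finset.range (m + 1),
      iteratedDeriv k f s * (x - s) ^ k / (k.factorial : ℝ))]
  · simp [Finset.sum_range_succ']
  · intro t ht
    rw [Set.uIcc_of_le hax] at ht
    exact hasDerivAt_sum_iteratedDeriv_mul_sub_pow x m fun k hk => hderiv k hk t ht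
  · exact (hint.continuousOn_mul (by fun_prop)).div_const _

/-- Hölder's inequality against the kernel `(x - t) ^ m`. -/
lemma abs_integral_sub_pow_mul_le {g : ℝ → ℝ} {a x α β : ℝ} (hax : a ≤ x) (m : ℕ)
    (hαβ : α.HolderConjugate β) (hg : IntervalIntegrable g volume a x)
    (hgα : IntervalIntegrable (fun t => |g t| ^ α) volume a x) :
    |∫ t in a..x, (x - t) ^ m * g t| ≤
      (x - a) ^ ((m : ℝ) + 1 / β) / ((m : ℝ) * β + 1) ^ (1 / β) *
        (∫ t in a..x, |g t| ^ α) ^ (1 / α) := by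
  have hmem : MemLp g (ENNReal.ofReal α) (volume.restrict (Set.Ioc a x)) := by
    rw [← integrable_norm_rpow_iff hg.1.aestronglyMeasurable
      (by simpa using hαβ.pos) ENNReal.ofReal_ne_top, ENNReal.toReal_ofReal hαβ.nonneg]
    exact hgα.1
  have hker : MemLp (fun t => |(x - t) ^ m|) (ENNReal.ofReal β)
      (volume.restrict (Set.Ioc a x)) := by
    refine MemLp.of_bound (by fun_prop) ((x - a) ^ m) ?_
    filter_upwards [ae_restrict_mem measurableSet_Ioc] with t ht
    rw [Real.norm_eq_abs, abs_abs, abs_pow, abs_of_nonneg (by linarith [ht.2])]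
    exact pow_le_pow_left₀ (by linarith [ht.2]) (by linarith [ht.1]) m
  have hholder := integral_mul_le_Lp_mul_Lq_of_nonneg hαβ.symm
    (f := fun t => |(x - t) ^ m|) (g := fun t => ‖g t‖)
    (.of_forall fun _ => abs_nonneg _) (.of_forall fun _ => norm_nonneg _) hker hmem.norm
  simp only [← intervalIntegral.integral_of_le hax, Real.norm_eq_abs] at hholder
  have hker_norm : (∫ t in a..x, |(x - t) ^ m| ^ β) ^ (1 / β) =
      (x - a) ^ ((m : ℝ) + 1 / β) / ((m : ℝ) * β + 1) ^ (1 / β) := by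
    rw [← integral_rpow_rpow_rpow_one_div (sub_nonneg.2 hax) m.cast_nonneg hαβ.symm.pos,
      ← sub_self x, ← integral_comp_sub_left (fun u => (u ^ (m : ℝ)) ^ β)]
    congr 1
    refine integral_congr fun t ht => ?_
    rw [Set.uIcc_of_le hax] at ht
    simp only [Real.rpow_natCast]
    rw [abs_of_nonneg (pow_nonneg (sub_nonneg.2 ht.2) m)]
  rw [← hker_norm]
  refine le_trans ?_ hholder
  simpa only [Real.norm_eq_abs, abs_mul] using
    norm_integral_le_integral_norm (f := fun t => (x - t) ^ m * g t) (μ := volume) hax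

/-- The `L^p` norm of `x ↦ c * (x - a) ^ r` on `[a, b]`. -/
lemma integral_const_mul_sub_rpow_rpow {a b c r p : ℝ} (hab : a ≤ b) (hc : 0 ≤ c) (hr : 0 ≤ r)
    (hp : 0 < p) :
    (∫ x in a..b, (c * (x - a) ^ r) ^ p) ^ (1 / p) =
      c * ((b - a) ^ (r + 1 / p) / (r * p + 1) ^ (1 / p)) := by
  have hcongr : ∫ x in a..b, (c * (x - a) ^ r) ^ p =
      c ^ p * ∫ u in (0 : ℝ)..(b - a), (u ^ r) ^ p := by
    rw [← sub_self a, ← integral_comp_sub_right (fun u => (u ^ r) ^ p),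
      ← intervalIntegral.integral_const_mul]
    refine integral_congr fun x hx => ?_
    rw [Set.uIcc_of_le hab] at hx
    exact Real.mul_rpow hc (Real.rpow_nonneg (sub_nonneg.2 hx.1) r)
  have hnonneg : 0 ≤ ∫ u in (0 : ℝ)..(b - a), (u ^ r) ^ p :=
    integral_nonneg (sub_nonneg.2 hab) fun u hu =>
      Real.rpow_nonneg (Real.rpow_nonneg hu.1 r) p
  rw [hcongr, Real.mul_rpow (Real.rpow_nonneg hc p) hnonneg, ← Real.rpow_mul hc,
    mul_one_div_cancel hp.ne', Real.rpow_one,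
    integral_rpow_rpow_rpow_one_div (sub_nonneg.2 hab) hr hp]

/-- Minkowski's inequality for a function dominated by a sum of two nonnegative
continuous functions. -/
lemma integral_abs_rpow_le_of_abs_le_add {R g h : ℝ → ℝ} {a b p : ℝ} (hab : a ≤ b) (hp : 1 ≤ p)
    (hg : Continuous g) (hh : Continuous h)
    (hg0 : ∀ x ∈ Set.Icc a b, 0 ≤ g x) (hh0 : ∀ x ∈ Set.Icc a b, 0 ≤ h x)
    (hR : ∀ x ∈ Set.Icc a b, |R x| ≤ g x + h x) :
    (∫ x in a..b, |R x| ^ p) ^ (1 / p) ≤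
      (∫ x in a..b, g x ^ p) ^ (1 / p) + (∫ x in a..b, h x ^ p) ^ (1 / p) := by
  have hp0 : 0 < p := by linarith
  have hnorm : ∀ φ : ℝ → ℝ, Continuous φ → (∀ x ∈ Set.Icc a b, 0 ≤ φ x) →
      lpNorm φ (ENNReal.ofReal p) (volume.restrict (Set.Ioc a b)) =
        (∫ x in a..b, φ x ^ p) ^ (1 / p) := by
    intro φ hφ hφ0
    rw [lpNorm_eq_integral_norm_rpow_toReal (by simpa using hp0) ENNReal.ofReal_ne_top
      hφ.aestronglyMeasurable, ENNReal.toReal_ofReal hp0.le, integral_of_le hab, one_div]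
    congr 1
    refine setIntegral_congr_fun measurableSet_Ioc fun x hx => ?_
    simp only [Real.norm_eq_abs, abs_of_nonneg (hφ0 x (Set.Ioc_subset_Icc_self hx))]
  have hmem : MemLp g (ENNReal.ofReal p) (volume.restrict (Set.Ioc a b)) := by
    obtain ⟨C, hC⟩ := (isCompact_Icc (a := a) (b := b)).exists_bound_of_continuousOn
      hg.continuousOn
    refine MemLp.of_bound hg.aestronglyMeasurable C ?_
    filter_upwards [ae_restrict_mem measurableSet_Ioc] with x hx
    exact hC x (Set.Ioc_subset_Icc_self hx)
  have hadd := lpNorm_add_le (g := h) hmem (by simpa using hp)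
  rw [hnorm _ (hg.add hh) fun x hx => add_nonneg (hg0 x hx) (hh0 x hx),
    hnorm g hg hg0, hnorm h hh hh0] at hadd
  refine le_trans (Real.rpow_le_rpow ?_ ?_ (by positivity)) hadd
  · exact integral_nonneg hab fun x _ => by positivity
  · rw [integral_of_le hab, integral_of_le hab]
    refine integral_mono_of_nonneg (.of_forall fun x => by positivity) ?_ ?_
    · exact (((hg.add hh).rpow_const fun _ => Or.inr hp0.le).intervalIntegrable a b).1
    · filter_upwards [ae_restrict_mem measurableSet_Ioc] with x hx
      exact Real.rpow_le_rpow (abs_nonneg _) (hR x (Set.Ioc_subset_Icc_self hx)) hp0.le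

/-- `L^p` estimate of the Taylor remainder (the `A₂` bound, Hölder case
`1 < α < ∞`, `1/α + 1/β = 1`). -/
theorem taylor_remainder_Lp_A2_estimate
    (a b : ℝ) (hab : a < b) (n : ℕ) (hn : 1 ≤ n) (p : ℝ) (hp : 1 ≤ p)
    (α β : ℝ) (hα : 1 < α) (hβ : 1 / α + 1 / β = 1)
    (f : ℝ → ℝ)
    (hderiv : ∀ k < n, ∀ x ∈ Set.Icc a b,
      HasDerivAt (iteratedDeriv k f) (iteratedDeriv (k + 1) f x) x)
    (hint : IntervalIntegrable (iteratedDeriv n f) volume a b)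
    (hα_int : IntervalIntegrable (fun t => |iteratedDeriv n f t| ^ α) volume a b) :
    (∫ x in a..b,
        |f x - ∑ k ∈ Finset.range (n + 1),
          iteratedDeriv k f a * (x - a) ^ k / (Nat.factorial k : ℝ)| ^ p)
      ^ (1 / p) ≤
      ((b - a) ^ ((n : ℝ) + 1 / p) /
        ((Nat.factorial n : ℝ) * ((n : ℝ) * p + 1) ^ (1 / p))) *
          |iteratedDeriv n f a| +
      ((b - a) ^ ((n : ℝ) - 1 + 1 / p + 1 / β) /
        ((Nat.factorial (n - 1) : ℝ) * (((n : ℝ) - 1) * β + 1) ^ (1 / β) *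
          (((n : ℝ) - 1 + 1 / β) * p + 1) ^ (1 / p))) *
        (∫ t in a..b, |iteratedDeriv n f t| ^ α) ^ (1 / α) := by
  obtain ⟨m, rfl⟩ : ∃ m, n = m + 1 := ⟨n - 1, by omega⟩
  have hαβ : α.HolderConjugate β :=
    Real.holderConjugate_iff.2 ⟨hα, by simpa only [one_div] using hβ⟩
  have hβ0 : 0 < β := hαβ.symm.pos
  have hp0 : 0 < p := by linarith
  set M := (∫ t in a..b, |iteratedDeriv (m + 1) f t| ^ α) ^ (1 / α) with hM
  have hM0 : 0 ≤ M :=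
    Real.rpow_nonneg (integral_nonneg hab.le fun t _ => by positivity) _
  set A := |iteratedDeriv (m + 1) f a| / ((m + 1).factorial : ℝ) with hA
  set B := M / ((m.factorial : ℝ) * ((m : ℝ) * β + 1) ^ (1 / β)) with hB
  have hA0 : 0 ≤ A := by positivity
  have hB0 : 0 ≤ B := by positivity
  have hr0 : 0 ≤ (m : ℝ) + 1 / β := by positivity
  have hn0 : (0 : ℝ) ≤ ((m + 1 : ℕ) : ℝ) := Nat.cast_nonneg _
  have hpointwise : ∀ x ∈ Set.Icc a b,
      |f x - ∑ k ∈ Finset.range (m + 1 + 1),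
        iteratedDeriv k f a * (x - a) ^ k / (Nat.factorial k : ℝ)| ≤
      A * (x - a) ^ ((m + 1 : ℕ) : ℝ) + B * (x - a) ^ ((m : ℝ) + 1 / β) := by
    intro x hx
    have hxa : 0 ≤ x - a := sub_nonneg.2 hx.1
    have hsub : Set.uIcc a x ⊆ Set.uIcc a b := by
      rw [Set.uIcc_of_le hx.1, Set.uIcc_of_le hab.le]
      exact Set.Icc_subset_Icc_right hx.2
    have htaylor := sub_sum_iteratedDeriv_eq_integral hx.1 m
      (fun k hk t ht => hderiv k (by omega) t ⟨ht.1, ht.2.trans hx.2⟩) (hint.mono_set hsub)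
    have hholder := abs_integral_sub_pow_mul_le hx.1 m hαβ (hint.mono_set hsub)
      (hα_int.mono_set hsub)
    have hmono : (∫ t in a..x, |iteratedDeriv (m + 1) f t| ^ α) ^ (1 / α) ≤ M := by
      refine Real.rpow_le_rpow (integral_nonneg hx.1 fun t _ => by positivity) ?_
        (one_div_nonneg.2 hαβ.nonneg)
      exact integral_mono_interval le_rfl hx.1 hx.2 (.of_forall fun t => by positivity) hα_int
    rw [Finset.sum_range_succ, ← sub_sub, htaylor, sub_eq_add_neg, add_comm]
    refine (abs_add_le _ _).trans (add_le_add (le_of_eq ?_) ?_)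
    · rw [abs_neg, abs_div, abs_mul, abs_of_nonneg (pow_nonneg hxa _), Nat.abs_cast,
        Real.rpow_natCast, hA]
      ring
    · rw [abs_div, Nat.abs_cast, div_le_iff₀ (by positivity)]
      refine (hholder.trans (mul_le_mul_of_nonneg_left hmono (by positivity))).trans_eq ?_
      have : (m.factorial : ℝ) ≠ 0 := by positivity
      rw [hB]
      field_simp
  have hcont : ∀ c r : ℝ, 0 ≤ r → Continuous fun x : ℝ => c * (x - a) ^ r := fun c r hr =>
    continuous_const.mul ((continuous_id.sub continuous_const).rpow_const fun _ => Or.inr hr)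
  have hnonneg : ∀ c r : ℝ, 0 ≤ c → ∀ x ∈ Set.Icc a b, 0 ≤ c * (x - a) ^ r :=
    fun c r hc x hx => mul_nonneg hc (Real.rpow_nonneg (sub_nonneg.2 hx.1) r)
  have hmain := integral_abs_rpow_le_of_abs_le_add hab.le hp (hcont A _ hn0) (hcont B _ hr0)
    (hnonneg A _ hA0) (hnonneg B _ hB0) hpointwise
  rw [integral_const_mul_sub_rpow_rpow hab.le hA0 hn0 hp0,
    integral_const_mul_sub_rpow_rpow hab.le hB0 hr0 hp0] at hmain
  refine hmain.trans_eq ?_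
  have hcast : ((m + 1 : ℕ) : ℝ) - 1 = m := by push_cast; ring
  rw [hcast, Nat.add_sub_cancel, hA, hB, add_right_comm (m : ℝ) (1 / p) (1 / β)]
  ring
end

section
/- Let a < b be real numbers, n ≥ 1 a natural number, and 1 ≤ p < ∞ a real number. Suppose f : ℝ → ℝ is such that for each k ≤ n the k-th derivative f^{(k)} exists at every point of [a,b], f^{(n)} is interval-integrable on [a,b], and ∫_a^b |f^{(n)}(t)|^p (b-t)^{(n-1)p+1} dt is finite. Then ‖R_n‖_p ≤ ((b-a)^{n+1/p} / (n! · (np+1)^{1/p})) · |f^{(n)}(a)| + ((b-a)^{1-1/p} / ((n-1)! · ((n-1)p+1)^{1/p})) · (∫_a^b |f^{(n)}(t)|^p (b-t)^{(n-1)p+1} dt)^{1/p}. -/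
open MeasureTheory intervalIntegral

/-- Taylor's formula with integral remainder, assuming only that the top derivative is
integrable. -/
theorem sub_taylor_eq_integral {a x : ℝ} (hax : a ≤ x) (m : ℕ) (f : ℝ → ℝ)
    (hderiv : ∀ k < m + 1, ∀ t ∈ Set.Icc a x,
      HasDerivAt (iteratedDeriv k f) (iteratedDeriv (k + 1) f t) t)
    (hint : IntervalIntegrable (iteratedDeriv (m + 1) f) volume a x) :
    f x - ∑ k ∈ Finset.range (m + 1), iteratedDeriv k f a * (x - a) ^ k / (k.factorial : ℝ) =
      ∫ t in a..x, iteratedDeriv (m + 1) f t * ((x - t) ^ m / (m.factorial : ℝ)) := by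
  have key : ∀ j ≤ m, ∀ t ∈ Set.Icc a x, HasDerivAt
      (fun t => ∑ k ∈ Finset.range (j + 1),
        iteratedDeriv k f t * (x - t) ^ k / (k.factorial : ℝ))
      (iteratedDeriv (j + 1) f t * ((x - t) ^ j / (j.factorial : ℝ))) t := by
    intro j
    induction j with
    | zero =>
      intro _ t ht
      simpa using hderiv 0 (by omega) t ht
    | succ j ih =>
      intro hj t ht
      have h1 := ih (by omega) t ht
      have h2 := hderiv (j + 1) (by omega) t ht
      have h3 : HasDerivAt (fun t => (x - t) ^ (j + 1))
          (((j + 1 : ℕ) : ℝ) * (x - t) ^ j * (-1)) t := by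
        simpa using ((hasDerivAt_id t).const_sub x).fun_pow (j + 1)
      have h4 := h1.add ((h2.mul h3).div_const ((j + 1).factorial : ℝ))
      simp_rw [Finset.sum_range_succ _ (j + 1)]
      refine h4.congr_deriv ?_
      rw [Nat.factorial_succ]
      push_cast
      field_simp
      ring
  have hI := integral_eq_sub_of_hasDerivAt (a := a) (b := x)
    (fun t ht => key m le_rfl t (by rwa [Set.uIcc_of_le hax] at ht))
    (hint.mul_continuousOn (by fun_prop))
  rw [hI]
  congr 1
  rw [Finset.sum_range_succ']
  simp

/-- Jensen's inequality for the `p`-th power of an interval integral. -/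
theorem enorm_integral_rpow_le {a x p : ℝ} (hax : a ≤ x) (hp : 1 ≤ p) {G : ℝ → ℝ}
    (hG : AEStronglyMeasurable G (volume.restrict (Set.Ioc a x))) :
    ‖∫ t in a..x, G t‖ₑ ^ p ≤
      ENNReal.ofReal (x - a) ^ (p - 1) * ∫⁻ t in Set.Ioc a x, ‖G t‖ₑ ^ p := by
  have hp0 : 0 < p := by linarith
  have h1 : ‖∫ t in a..x, G t‖ₑ ≤ eLpNorm G 1 (volume.restrict (Set.Ioc a x)) := by
    rw [integral_of_le hax, eLpNorm_one_eq_lintegral_enorm]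
    exact enorm_integral_le_lintegral_enorm _
  have h2 := eLpNorm_le_eLpNorm_mul_rpow_measure_univ (p := 1) (q := ENNReal.ofReal p)
    (by simpa using hp) hG
  have h3 := ENNReal.rpow_le_rpow (h1.trans h2) hp0.le
  refine h3.trans (le_of_eq ?_)
  rw [ENNReal.mul_rpow_of_nonneg _ _ hp0.le, ← ENNReal.rpow_mul,
    eLpNorm_eq_lintegral_rpow_enorm_toReal (by simpa using hp0) (by simp),
    ENNReal.toReal_ofReal hp0.le, ← ENNReal.rpow_mul, mul_comm]
  simp only [Measure.restrict_apply_univ, Real.volume_Ioc, ENNReal.toReal_one]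
  congr 2
  · field_simp
  · rw [one_div_mul_cancel hp0.ne', ENNReal.rpow_one]

/-- Minkowski's inequality for continuous functions on a compact interval. -/
theorem integral_rpow_add_le {a b p : ℝ} (hab : a ≤ b) (hp : 1 ≤ p) {g h : ℝ → ℝ}
    (hg : ContinuousOn g (Set.Icc a b)) (hh : ContinuousOn h (Set.Icc a b)) :
    (∫ x in a..b, |g x + h x| ^ p) ^ (1 / p) ≤
      (∫ x in a..b, |g x| ^ p) ^ (1 / p) + (∫ x in a..b, |h x| ^ p) ^ (1 / p) := by
  have hp0 : 0 < p := by linarith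
  have hmem : ∀ {u : ℝ → ℝ}, ContinuousOn u (Set.Icc a b) →
      MemLp u (ENNReal.ofReal p) (volume.restrict (Set.Ioc a b)) := by
    intro u hu
    obtain ⟨C, hC⟩ := isCompact_Icc.exists_bound_of_continuousOn hu
    refine MemLp.of_bound ((hu.mono Set.Ioc_subset_Icc_self).aestronglyMeasurable
      measurableSet_Ioc) C ?_
    filter_upwards [ae_restrict_mem measurableSet_Ioc] with x hx
    exact hC x (Set.Ioc_subset_Icc_self hx)
  have heq : ∀ {u : ℝ → ℝ}, ContinuousOn u (Set.Icc a b) →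
      (∫ x in a..b, |u x| ^ p) ^ (1 / p) =
        (eLpNorm u (ENNReal.ofReal p) (volume.restrict (Set.Ioc a b))).toReal := by
    intro u hu
    rw [(hmem hu).eLpNorm_eq_integral_rpow_norm (by simpa using hp0) (by simp),
      ENNReal.toReal_ofReal hp0.le, ENNReal.toReal_ofReal, integral_of_le hab, one_div]
    · rfl
    · exact Real.rpow_nonneg (integral_nonneg fun x => by positivity) _
  rw [heq hg, heq hh, heq (u := fun x => g x + h x) (hg.add hh),
    ← ENNReal.toReal_add (hmem hg).2.ne (hmem hh).2.ne]
  exact ENNReal.toReal_mono (ENNReal.add_ne_top.2 ⟨(hmem hg).2.ne, (hmem hh).2.ne⟩)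
    (eLpNorm_add_le (hmem hg).1 (hmem hh).1 (by simpa using hp))

theorem integral_sub_rpow {t b q : ℝ} (hq : 0 ≤ q) :
    ∫ x in t..b, (x - t) ^ q = (b - t) ^ (q + 1) / (q + 1) := by
  rw [integral_comp_sub_right (fun x => x ^ q) t, integral_rpow (Or.inl (by linarith)), sub_self,
    Real.zero_rpow (by linarith), sub_zero]

theorem lintegral_sub_rpow {t b q : ℝ} (htb : t ≤ b) (hq : 0 ≤ q) :
    ∫⁻ x in Set.Icc t b, ENNReal.ofReal ((x - t) ^ q) =
      ENNReal.ofReal ((b - t) ^ (q + 1) / (q + 1)) := by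
  rw [← integral_sub_rpow hq, integral_of_le htb, ← integral_Icc_eq_integral_Ioc,
    ofReal_integral_eq_lintegral_ofReal]
  · refine ContinuousOn.integrableOn_Icc ?_
    exact (ContinuousOn.rpow_const (by fun_prop) fun _ _ => Or.inr hq)
  · filter_upwards [ae_restrict_mem measurableSet_Icc] with x hx
    exact Real.rpow_nonneg (sub_nonneg.2 hx.1) _

/-- Integrating a fractional integral over `(a, b]`, by Tonelli's theorem. -/
theorem lintegral_lintegral_mul_sub_rpow {a b q : ℝ} (hq : 0 ≤ q) {g : ℝ → ENNReal}
    (hg : AEMeasurable g (volume.restrict (Set.Ioc a b))) :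
    ∫⁻ x in Set.Ioc a b, ∫⁻ t in Set.Ioc a x, g t * ENNReal.ofReal ((x - t) ^ q) =
      ∫⁻ t in Set.Ioc a b, g t * ENNReal.ofReal ((b - t) ^ (q + 1) / (q + 1)) := by
  let S : Set (ℝ × ℝ) := {z | z.2 ≤ z.1}
  have hS : MeasurableSet S := measurableSet_le measurable_snd measurable_fst
  let k : ℝ → ℝ → ENNReal := fun x t =>
    S.indicator (fun z : ℝ × ℝ => ENNReal.ofReal ((z.1 - z.2) ^ q)) (x, t)
  have hk : Measurable (Function.uncurry k) := by
    have : Measurable (fun z : ℝ × ℝ => ENNReal.ofReal ((z.1 - z.2) ^ q)) := by fun_prop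
    exact this.indicator hS
  calc
    _ = ∫⁻ x in Set.Ioc a b, ∫⁻ t in Set.Ioc a b, g t * k x t := by
      refine setLIntegral_congr_fun measurableSet_Ioc fun x hx => ?_
      have : Set.Ioc a x = Set.Iic x ∩ Set.Ioc a b := by
        ext t; simp only [Set.mem_Ioc, Set.mem_inter_iff, Set.mem_Iic]
        exact ⟨fun h => ⟨h.2, h.1, h.2.trans hx.2⟩, fun h => ⟨h.2.1, h.1⟩⟩
      rw [this, ← setLIntegral_indicator measurableSet_Iic]
      refine lintegral_congr fun t => ?_
      by_cases h : t ≤ x <;> simp [k, S, Set.indicator, h]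
    _ = ∫⁻ t in Set.Ioc a b, ∫⁻ x in Set.Ioc a b, g t * k x t := by
      refine lintegral_lintegral_swap ?_
      exact hg.comp_snd.mul hk.aemeasurable
    _ = _ := by
      refine setLIntegral_congr_fun measurableSet_Ioc fun t ht => ?_
      have : Set.Icc t b = Set.Ici t ∩ Set.Ioc a b := by
        ext x; simp only [Set.mem_Ioc, Set.mem_inter_iff, Set.mem_Ici, Set.mem_Icc]
        exact ⟨fun h => ⟨h.1, ht.1.trans_le h.1, h.2⟩, fun h => ⟨h.1, h.2.2⟩⟩
      rw [lintegral_const_mul (g t) (f := fun x => k x t)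
          (hk.comp (measurable_id.prodMk measurable_const)),
        ← lintegral_sub_rpow ht.2 hq, this, ← setLIntegral_indicator measurableSet_Ici]
      congr 1

/-- Bound on the `p`-th power of the `L^p` norm of the Taylor remainder of order `m`. -/
theorem integral_rpow_sub_taylor_le {a b p : ℝ} (hab : a < b) (m : ℕ) (hp : 1 ≤ p) (f : ℝ → ℝ)
    (hderiv : ∀ k < m + 1, ∀ x ∈ Set.Icc a b,
      HasDerivAt (iteratedDeriv k f) (iteratedDeriv (k + 1) f x) x)
    (hint : IntervalIntegrable (iteratedDeriv (m + 1) f) volume a b)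
    (hw_int : IntervalIntegrable
      (fun t => |iteratedDeriv (m + 1) f t| ^ p * (b - t) ^ ((m : ℝ) * p + 1)) volume a b) :
    ∫ x in a..b, |f x - ∑ k ∈ Finset.range (m + 1),
        iteratedDeriv k f a * (x - a) ^ k / (k.factorial : ℝ)| ^ p ≤
      (b - a) ^ (p - 1) / ((m.factorial : ℝ) ^ p * ((m : ℝ) * p + 1)) *
        ∫ t in a..b, |iteratedDeriv (m + 1) f t| ^ p * (b - t) ^ ((m : ℝ) * p + 1) := by
  have hp0 : 0 < p := by linarith
  have hq : 0 ≤ (m : ℝ) * p := by positivity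
  have hba : 0 < b - a := sub_pos.2 hab
  set F := iteratedDeriv (m + 1) f
  have hFm : AEStronglyMeasurable F (volume.restrict (Set.Ioc a b)) := hint.1.1
  have hW0 : 0 ≤ᵐ[volume.restrict (Set.Ioc a b)]
      fun t => |F t| ^ p * (b - t) ^ ((m : ℝ) * p + 1) := by
    filter_upwards [ae_restrict_mem measurableSet_Ioc] with t ht
    have := sub_nonneg.2 ht.2
    simp only [Pi.zero_apply]
    positivity
  have hRHS : 0 ≤ (b - a) ^ (p - 1) / ((m.factorial : ℝ) ^ p * ((m : ℝ) * p + 1)) *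
      ∫ t in a..b, |F t| ^ p * (b - t) ^ ((m : ℝ) * p + 1) := by
    refine mul_nonneg (by positivity) ?_
    rw [integral_of_le hab.le]
    exact integral_nonneg_of_ae hW0
  have hfc : ContinuousOn f (Set.Icc a b) := fun x hx => by
    simpa using (hderiv 0 (by omega) x hx).continuousAt.continuousWithinAt
  rw [integral_of_le hab.le, integral_eq_lintegral_of_nonneg_ae]
  rotate_left
  · exact Filter.Eventually.of_forall fun x => by positivity
  · refine ContinuousOn.aestronglyMeasurable ?_ measurableSet_Ioc
    refine ContinuousOn.rpow_const ?_ fun _ _ => Or.inr hp0.le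
    exact ((hfc.mono Set.Ioc_subset_Icc_self).sub (by fun_prop)).abs
  refine ENNReal.toReal_le_of_le_ofReal hRHS ?_
  let g : ℝ → ENNReal := fun t => ENNReal.ofReal (|F t| ^ p / (m.factorial : ℝ) ^ p)
  have hg : AEMeasurable g (volume.restrict (Set.Ioc a b)) := by
    have := hFm.aemeasurable
    fun_prop
  calc
    _ ≤ ∫⁻ x in Set.Ioc a b, ENNReal.ofReal (b - a) ^ (p - 1) *
          ∫⁻ t in Set.Ioc a x, g t * ENNReal.ofReal ((x - t) ^ ((m : ℝ) * p)) := by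
      refine setLIntegral_mono' measurableSet_Ioc fun x hx => ?_
      have hsub : Set.Icc a x ⊆ Set.Icc a b := Set.Icc_subset_Icc_right hx.2
      rw [sub_taylor_eq_integral hx.1.le m f (fun k hk t ht => hderiv k hk t (hsub ht))
        (hint.mono_set (by rwa [Set.uIcc_of_le hx.1.le, Set.uIcc_of_le hab.le])),
        ← ENNReal.ofReal_rpow_of_nonneg (abs_nonneg _) hp0.le, ← Real.norm_eq_abs,
        ofReal_norm]
      refine (enorm_integral_rpow_le hx.1.le hp ?_).trans ?_
      · exact (hFm.mono_measure (Measure.restrict_mono (Set.Ioc_subset_Ioc_right hx.2) le_rfl)).mul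
          (by fun_prop)
      · refine mul_le_mul' (ENNReal.rpow_le_rpow (ENNReal.ofReal_le_ofReal (by linarith [hx.2]))
          (by linarith)) (le_of_eq ?_)
        refine setLIntegral_congr_fun measurableSet_Ioc fun t ht => ?_
        have hxt : 0 ≤ x - t := sub_nonneg.2 ht.2
        simp only [g]
        rw [← ENNReal.ofReal_mul (by positivity), ← ofReal_norm,
          ENNReal.ofReal_rpow_of_nonneg (norm_nonneg _) hp0.le, Real.norm_eq_abs, abs_mul,
          abs_of_nonneg (by positivity : 0 ≤ (x - t) ^ m / (m.factorial : ℝ)),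
          Real.mul_rpow (abs_nonneg _) (by positivity),
          Real.div_rpow (by positivity) (by positivity), Real.rpow_mul hxt, Real.rpow_natCast]
        congr 1
        ring
    _ = ENNReal.ofReal (b - a) ^ (p - 1) * ∫⁻ t in Set.Ioc a b,
          g t * ENNReal.ofReal ((b - t) ^ ((m : ℝ) * p + 1) / ((m : ℝ) * p + 1)) := by
      rw [lintegral_const_mul' _ _ (ENNReal.rpow_ne_top_of_nonneg (by linarith) (by simp)),
        lintegral_lintegral_mul_sub_rpow hq hg]
    _ = _ := by
      rw [integral_of_le hab.le, ENNReal.ofReal_mul (by positivity),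
        ofReal_integral_eq_lintegral_ofReal hw_int.1 hW0,
        ENNReal.ofReal_rpow_of_nonneg hba.le (by linarith),
        ← lintegral_const_mul' _ _ (by simp), ← lintegral_const_mul' _ _ (by simp)]
      refine setLIntegral_congr_fun measurableSet_Ioc fun t ht => ?_
      have hbt : 0 ≤ b - t := sub_nonneg.2 ht.2
      simp only [g]
      rw [← ENNReal.ofReal_mul (by positivity), ← ENNReal.ofReal_mul (by positivity),
        ← ENNReal.ofReal_mul (by positivity)]
      congr 1
      field_simp

/-- `L^p` estimate of the Taylor remainder (the `A₃` bound, weighted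
integral of `|f⁽ⁿ⁾|^p`). -/
theorem taylor_remainder_Lp_A3_estimate
    (a b : ℝ) (hab : a < b) (n : ℕ) (hn : 1 ≤ n) (p : ℝ) (hp : 1 ≤ p)
    (f : ℝ → ℝ)
    (hderiv : ∀ k < n, ∀ x ∈ Set.Icc a b,
      HasDerivAt (iteratedDeriv k f) (iteratedDeriv (k + 1) f x) x)
    (hint : IntervalIntegrable (iteratedDeriv n f) volume a b)
    (hw_int : IntervalIntegrable
      (fun t => |iteratedDeriv n f t| ^ p * (b - t) ^ (((n : ℝ) - 1) * p + 1))
      volume a b) :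
    (∫ x in a..b,
        |f x - ∑ k ∈ Finset.range (n + 1),
          iteratedDeriv k f a * (x - a) ^ k / (Nat.factorial k : ℝ)| ^ p)
      ^ (1 / p) ≤
      ((b - a) ^ ((n : ℝ) + 1 / p) /
        ((Nat.factorial n : ℝ) * ((n : ℝ) * p + 1) ^ (1 / p))) *
          |iteratedDeriv n f a| +
      ((b - a) ^ (1 - 1 / p) /
        ((Nat.factorial (n - 1) : ℝ) * (((n : ℝ) - 1) * p + 1) ^ (1 / p))) *
        (∫ t in a..b,
          |iteratedDeriv n f t| ^ p * (b - t) ^ (((n : ℝ) - 1) * p + 1))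
          ^ (1 / p) := by
  obtain ⟨m, rfl⟩ : ∃ m, n = m + 1 := ⟨n - 1, by omega⟩
  have hp0 : 0 < p := by linarith
  have hba : 0 < b - a := sub_pos.2 hab
  simp only [Nat.cast_add, Nat.cast_one, add_sub_cancel_right, Nat.add_sub_cancel] at hw_int ⊢
  have hW0 : 0 ≤ ∫ t in a..b, |iteratedDeriv (m + 1) f t| ^ p * (b - t) ^ ((m : ℝ) * p + 1) := by
    refine integral_nonneg hab.le fun t ht => ?_
    have := sub_nonneg.2 ht.2
    positivity
  have hfc : ContinuousOn f (Set.Icc a b) := fun x hx => by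
    simpa using (hderiv 0 (by omega) x hx).continuousAt.continuousWithinAt
  have hM := integral_rpow_add_le hab.le hp
    (g := fun x => -(iteratedDeriv (m + 1) f a * (x - a) ^ (m + 1) / ((m + 1).factorial : ℝ)))
    (h := fun x => f x - ∑ k ∈ Finset.range (m + 1),
      iteratedDeriv k f a * (x - a) ^ k / (k.factorial : ℝ))
    (by fun_prop) (hfc.sub (by fun_prop))
  have hlead : (∫ x in a..b, |-(iteratedDeriv (m + 1) f a * (x - a) ^ (m + 1) /
      ((m + 1).factorial : ℝ))| ^ p) ^ (1 / p) =
      ((b - a) ^ ((m : ℝ) + 1 + 1 / p) /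
        (((m + 1).factorial : ℝ) * (((m : ℝ) + 1) * p + 1) ^ (1 / p))) *
          |iteratedDeriv (m + 1) f a| := by
    have hcongr : ∫ x in a..b, |-(iteratedDeriv (m + 1) f a * (x - a) ^ (m + 1) /
        ((m + 1).factorial : ℝ))| ^ p =
        ∫ x in a..b, (|iteratedDeriv (m + 1) f a| / ((m + 1).factorial : ℝ)) ^ p *
          (x - a) ^ (((m : ℝ) + 1) * p) := by
      refine integral_congr fun x hx => ?_
      rw [Set.uIcc_of_le hab.le] at hx
      have hxa : 0 ≤ x - a := sub_nonneg.2 hx.1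
      rw [abs_neg, abs_div, abs_mul, abs_of_nonneg (pow_nonneg hxa _), Nat.abs_cast,
        Real.rpow_mul hxa, ← Nat.cast_succ, Real.rpow_natCast, mul_div_right_comm,
        Real.mul_rpow (by positivity) (by positivity)]
    rw [hcongr, intervalIntegral.integral_const_mul, integral_sub_rpow (by positivity),
      Real.mul_rpow (by positivity) (by positivity), ← Real.rpow_mul (by positivity),
      mul_one_div_cancel hp0.ne', Real.rpow_one, Real.div_rpow (by positivity) (by positivity),
      ← Real.rpow_mul hba.le]
    have : (((m : ℝ) + 1) * p + 1) * (1 / p) = (m : ℝ) + 1 + 1 / p := by field_simp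
    rw [this]
    ring
  have htail := Real.rpow_le_rpow (integral_nonneg hab.le fun x _ => by positivity)
    (integral_rpow_sub_taylor_le hab m hp f hderiv hint hw_int) (by positivity : 0 ≤ 1 / p)
  rw [Real.mul_rpow (by positivity) hW0, Real.div_rpow (by positivity) (by positivity),
    Real.mul_rpow (by positivity) (by positivity), ← Real.rpow_mul hba.le,
    ← Real.rpow_mul (by positivity), mul_one_div_cancel hp0.ne', Real.rpow_one,
    (by field_simp : (p - 1) * (1 / p) = 1 - 1 / p)] at htail
  rw [hlead] at hM
  refine le_trans (le_of_eq ?_) (hM.trans (add_le_add_right htail _))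
  congr 2
  funext x
  rw [Finset.sum_range_succ _ (m + 1)]
  congr 2
  ring
end

section
/- Let a < b be real numbers, n ≥ 1 a natural number, and 1 ≤ p < ∞ a real number. Suppose f : ℝ → ℝ is such that for each k ≤ n the k-th derivative f^{(k)} exists at every point of [a,b], f^{(n)} is interval-integrable on [a,b], and ∫_a^b |f^{(n)}(t)|^p (b-t)^n dt is finite. Then ‖R_n‖_p ≤ ((b-a)^{n+1/p} / (n! · (np+1)^{1/p})) · |f^{(n)}(a)| + ((b-a)^{n(1-1/p)} / n!) · (∫_a^b |f^{(n)}(t)|^p (b-t)^n dt)^{1/p}. -/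
open MeasureTheory intervalIntegral
theorem hasDerivAt_taylor_center {f : ℝ → ℝ} {t : ℝ} (x : ℝ) (m : ℕ)
    (h : ∀ k ≤ m, HasDerivAt (iteratedDeriv k f) (iteratedDeriv (k + 1) f t) t) :
    HasDerivAt (fun s => ∑ k ∈ Finset.range (m + 1),
        iteratedDeriv k f s * (x - s) ^ k / (Nat.factorial k : ℝ))
      (iteratedDeriv (m + 1) f t * (x - t) ^ m / (Nat.factorial m : ℝ)) t := by
  induction m with
  | zero => simpa using h 0 le_rfl
  | succ m ih =>
    have hpow : HasDerivAt (fun s => (x - s) ^ (m + 1))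
        (((m + 1 : ℕ) : ℝ) * (x - t) ^ m * (-1)) t := by
      simpa using ((hasDerivAt_id t).const_sub x).fun_pow (m + 1)
    have hsum := (ih fun k hk => h k (hk.trans m.le_succ)).fun_add
      (((h (m + 1) le_rfl).fun_mul hpow).div_const (Nat.factorial (m + 1) : ℝ))
    simp_rw [Finset.sum_range_succ _ (m + 1)]
    refine hsum.congr_deriv ?_
    have h1 : (Nat.factorial m : ℝ) ≠ 0 := by positivity
    have h2 : (m + 1 : ℝ) ≠ 0 := by positivity
    rw [Nat.factorial_succ]
    push_cast
    field_simp
    ring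

theorem taylor_remainder_eq_integral {f : ℝ → ℝ} {a x : ℝ} (hax : a ≤ x) (m : ℕ)
    (h : ∀ k ≤ m, ∀ t ∈ Set.Icc a x,
      HasDerivAt (iteratedDeriv k f) (iteratedDeriv (k + 1) f t) t)
    (hint : IntervalIntegrable (iteratedDeriv (m + 1) f) volume a x) :
    f x - ∑ k ∈ Finset.range (m + 1),
        iteratedDeriv k f a * (x - a) ^ k / (Nat.factorial k : ℝ) =
      ∫ t in a..x, iteratedDeriv (m + 1) f t * (x - t) ^ m / (Nat.factorial m : ℝ) := by
  have hcont : IntervalIntegrable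
      (fun t => iteratedDeriv (m + 1) f t * (x - t) ^ m / (Nat.factorial m : ℝ)) volume a x :=
    (hint.mul_continuousOn (by fun_prop)).div_const _
  rw [integral_eq_sub_of_hasDerivAt (fun t ht => hasDerivAt_taylor_center x m fun k hk =>
    h k hk t (by rwa [Set.uIcc_of_le hax] at ht)) hcont]
  congr 1
  simp [Finset.sum_range_succ']

/-- The kernel `(x - t)₊ ^ m`, with the convention that it is `1` on `t ≤ x` when `m = 0`. -/
noncomputable def truncPowKernel (m : ℕ) (x t : ℝ) : ENNReal :=
  (Set.Iic x).indicator (fun t => ENNReal.ofReal ((x - t) ^ m)) t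

theorem measurable_truncPowKernel (m : ℕ) :
    Measurable (Function.uncurry (truncPowKernel m)) := by
  have : Function.uncurry (truncPowKernel m) = Set.indicator {z : ℝ × ℝ | z.2 ≤ z.1}
      (fun z => ENNReal.ofReal ((z.1 - z.2) ^ m)) := by
    ext ⟨x, t⟩
    simp [truncPowKernel, Set.indicator]
  rw [this]
  exact Measurable.indicator (by fun_prop) (measurableSet_le measurable_snd measurable_fst)

theorem lintegral_Ioc_ofReal_pow_sub {c x : ℝ} (h : c ≤ x) (m : ℕ) :
    ∫⁻ t in Set.Ioc c x, ENNReal.ofReal ((x - t) ^ m) =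
      ENNReal.ofReal ((x - c) ^ (m + 1) / (m + 1)) := by
  rw [← ofReal_integral_eq_lintegral_ofReal, ← integral_of_le h,
    integral_comp_sub_left (fun t => t ^ m) x, integral_pow]
  · simp
  · exact (Continuous.integrableOn_Icc (by fun_prop)).mono_set Set.Ioc_subset_Icc_self
  · filter_upwards [ae_restrict_mem measurableSet_Ioc] with t ht
    exact pow_nonneg (sub_nonneg.2 ht.2) m

theorem lintegral_Ioc_ofReal_sub_pow {c x : ℝ} (h : c ≤ x) (m : ℕ) :
    ∫⁻ t in Set.Ioc c x, ENNReal.ofReal ((t - c) ^ m) =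
      ENNReal.ofReal ((x - c) ^ (m + 1) / (m + 1)) := by
  rw [← ofReal_integral_eq_lintegral_ofReal, ← integral_of_le h,
    integral_comp_sub_right (fun t => t ^ m) c, integral_pow]
  · simp
  · exact (Continuous.integrableOn_Icc (by fun_prop)).mono_set Set.Ioc_subset_Icc_self
  · filter_upwards [ae_restrict_mem measurableSet_Ioc] with t ht
    exact pow_nonneg (sub_nonneg.2 ht.1.le) m

theorem lintegral_mul_truncPowKernel {a b x : ℝ} (hx : x ∈ Set.Ioc a b) (m : ℕ)
    (F : ℝ → ENNReal) :
    ∫⁻ t in Set.Ioc a b, F t * truncPowKernel m x t =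
      ∫⁻ t in Set.Ioc a x, F t * ENNReal.ofReal ((x - t) ^ m) := by
  have : (fun t => F t * truncPowKernel m x t) =
      (Set.Iic x).indicator (fun t => F t * ENNReal.ofReal ((x - t) ^ m)) := by
    ext t
    simp [truncPowKernel, Set.indicator]
  rw [this, setLIntegral_indicator measurableSet_Iic, Set.inter_comm, Set.Ioc_inter_Iic,
    min_eq_right hx.2]

theorem lintegral_truncPowKernel_left {a b t : ℝ} (ht : t ∈ Set.Ioc a b) (m : ℕ) :
    ∫⁻ x in Set.Ioc a b, truncPowKernel m x t =
      ENNReal.ofReal ((b - t) ^ (m + 1) / (m + 1)) := by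
  have : (fun x => truncPowKernel m x t) =
      (Set.Ici t).indicator (fun x => ENNReal.ofReal ((x - t) ^ m)) := by
    ext x
    simp [truncPowKernel, Set.indicator]
  rw [this, setLIntegral_indicator measurableSet_Ici, ← lintegral_Ioc_ofReal_sub_pow ht.2 m]
  have : Set.Ici t ∩ Set.Ioc a b = Set.Icc t b := by
    ext y; simp only [Set.mem_inter_iff, Set.mem_Ici, Set.mem_Ioc, Set.mem_Icc]
    exact ⟨fun h => ⟨h.1, h.2.2⟩, fun h => ⟨h.1, ht.1.trans_le h.1, h.2⟩⟩
  rw [this, restrict_Ioc_eq_restrict_Icc]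

theorem lintegral_mul_rpow_le {α : Type*} [MeasurableSpace α] {μ : Measure α} {p : ℝ}
    (hp : 1 ≤ p) {F w : α → ENNReal} (hF : AEMeasurable F μ) (hw : AEMeasurable w μ) :
    (∫⁻ x, F x * w x ∂μ) ^ p ≤ (∫⁻ x, F x ^ p * w x ∂μ) * (∫⁻ x, w x ∂μ) ^ (p - 1) := by
  have hp0 : 0 < p := by linarith
  have hq : 0 ≤ 1 - 1 / p := by
    rw [sub_nonneg, div_le_one hp0]; exact hp
  have key := ENNReal.lintegral_mul_norm_pow_le (μ := μ) ((hF.pow_const p).mul hw) hw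
    (p := 1 / p) (q := 1 - 1 / p) (by positivity) hq (by ring)
  have heq : ∀ x, (F x ^ p * w x) ^ (1 / p) * w x ^ (1 - 1 / p) = F x * w x := by
    intro x
    rw [ENNReal.mul_rpow_of_nonneg _ _ (by positivity), ← ENNReal.rpow_mul, mul_assoc,
      ← ENNReal.rpow_add_of_nonneg _ _ (by positivity) hq]
    simp [hp0.ne']
  simp only [Pi.mul_apply, heq] at key
  calc _ ≤ _ := ENNReal.rpow_le_rpow key hp0.le
    _ = _ := by
      rw [ENNReal.mul_rpow_of_nonneg _ _ hp0.le, ← ENNReal.rpow_mul, ← ENNReal.rpow_mul,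
        one_div_mul_cancel hp0.ne', sub_mul, one_div_mul_cancel hp0.ne', one_mul, ENNReal.rpow_one]

theorem lintegral_rpow_lintegral_mul_pow_le {a b p : ℝ} (hp : 1 ≤ p) (m : ℕ)
    {F : ℝ → ENNReal} (hF : AEMeasurable F (volume.restrict (Set.Ioc a b))) :
    ∫⁻ x in Set.Ioc a b, (∫⁻ t in Set.Ioc a x, F t * ENNReal.ofReal ((x - t) ^ m)) ^ p ≤
      (∫⁻ t in Set.Ioc a b, F t ^ p * ENNReal.ofReal ((b - t) ^ (m + 1) / (m + 1))) *
        ENNReal.ofReal ((b - a) ^ (m + 1) / (m + 1)) ^ (p - 1) := by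
  have hK := measurable_truncPowKernel m
  calc
    _ ≤ ∫⁻ x in Set.Ioc a b, (∫⁻ t in Set.Ioc a b, F t ^ p * truncPowKernel m x t) *
        ENNReal.ofReal ((b - a) ^ (m + 1) / (m + 1)) ^ (p - 1) := by
      refine setLIntegral_mono' measurableSet_Ioc fun x hx => ?_
      rw [lintegral_mul_truncPowKernel hx]
      refine (lintegral_mul_rpow_le hp (hF.mono_measure
        (Measure.restrict_mono (Set.Ioc_subset_Ioc_right hx.2) le_rfl)) (by fun_prop)).trans ?_
      rw [lintegral_Ioc_ofReal_pow_sub hx.1.le]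
      have h0 : 0 ≤ x - a := sub_nonneg.2 hx.1.le
      have h1 : x - a ≤ b - a := by linarith [hx.2]
      have h2 : 0 ≤ p - 1 := sub_nonneg.2 hp
      gcongr
    _ = (∫⁻ x in Set.Ioc a b, ∫⁻ t in Set.Ioc a b, F t ^ p * truncPowKernel m x t) *
        ENNReal.ofReal ((b - a) ^ (m + 1) / (m + 1)) ^ (p - 1) :=
      lintegral_mul_const' _ _ (ENNReal.rpow_ne_top_of_nonneg (sub_nonneg.2 hp)
        ENNReal.ofReal_ne_top)
    _ = _ := by
      rw [lintegral_lintegral_swap ((hF.pow_const p).comp_snd.mul hK.aemeasurable)]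
      congr 1
      refine setLIntegral_congr_fun measurableSet_Ioc fun t ht => ?_
      have hKt : Measurable fun x => truncPowKernel m x t := hK.comp measurable_prodMk_right
      rw [lintegral_const_mul _ hKt, lintegral_truncPowKernel_left ht]

theorem eLpNorm_eq_ofReal_integral_rpow {α : Type*} [MeasurableSpace α] {μ : Measure α} {p : ℝ}
    (hp : 1 ≤ p) {h : α → ℝ} (hh : Integrable (fun x => |h x| ^ p) μ) :
    eLpNorm h (ENNReal.ofReal p) μ = ENNReal.ofReal ((∫ x, |h x| ^ p ∂μ) ^ (1 / p)) := by
  have hp0 : 0 < p := by linarith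
  have hnn : ∀ x, 0 ≤ |h x| ^ p := fun x => by positivity
  rw [eLpNorm_eq_lintegral_rpow_enorm_toReal (by simpa using hp0) ENNReal.ofReal_ne_top,
    ENNReal.toReal_ofReal hp0.le,
    ← ENNReal.ofReal_rpow_of_nonneg (integral_nonneg hnn) (by positivity),
    ofReal_integral_eq_lintegral_ofReal hh (ae_of_all _ hnn)]
  congr 1
  refine lintegral_congr fun x => ?_
  rw [Real.enorm_eq_ofReal_abs, ENNReal.ofReal_rpow_of_nonneg (abs_nonneg _) hp0.le]

theorem eLpNorm_const_mul_pow {a b p : ℝ} (hab : a < b) (hp : 1 ≤ p) (n : ℕ) (c : ℝ) :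
    eLpNorm (fun x => c * (x - a) ^ n) (ENNReal.ofReal p) (volume.restrict (Set.Ioc a b)) =
      ENNReal.ofReal ((b - a) ^ ((n : ℝ) + 1 / p) / ((n : ℝ) * p + 1) ^ (1 / p) * |c|) := by
  have hp0 : 0 < p := by linarith
  have hba : 0 < b - a := sub_pos.2 hab
  have hint : IntegrableOn (fun x => |c * (x - a) ^ n| ^ p) (Set.Ioc a b) :=
    (ContinuousOn.integrableOn_Icc (ContinuousOn.rpow_const (by fun_prop)
      fun _ _ => Or.inr hp0.le)).mono_set Set.Ioc_subset_Icc_self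
  rw [eLpNorm_eq_ofReal_integral_rpow hp hint]
  congr 1
  have heq : ∫ x in Set.Ioc a b, |c * (x - a) ^ n| ^ p =
      |c| ^ p * ((b - a) ^ ((n : ℝ) * p + 1) / ((n : ℝ) * p + 1)) := by
    rw [setIntegral_congr_fun (g := fun x => |c| ^ p * (x - a) ^ ((n : ℝ) * p)) measurableSet_Ioc,
      MeasureTheory.integral_const_mul, ← integral_of_le hab.le,
      integral_comp_sub_right (fun t => t ^ ((n : ℝ) * p)) a, integral_rpow, sub_self,
      Real.zero_rpow (by positivity), sub_zero]
    · left
      have : 0 ≤ (n : ℝ) * p := by positivity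
      linarith
    · intro x hx
      have hx0 : 0 ≤ x - a := sub_nonneg.2 hx.1.le
      simp only
      rw [abs_mul, abs_of_nonneg (pow_nonneg hx0 n), Real.mul_rpow (abs_nonneg _) (by positivity),
        Real.rpow_natCast_mul hx0]
  rw [heq, Real.mul_rpow (by positivity) (by positivity), ← Real.rpow_mul (abs_nonneg _),
    mul_one_div_cancel hp0.ne', Real.rpow_one, Real.div_rpow (by positivity) (by positivity),
    ← Real.rpow_mul hba.le, mul_comm]
  congr 3
  field_simp

theorem eLpNorm_taylor_remainder_le {a b p : ℝ} (hab : a < b) (hp : 1 ≤ p) (m : ℕ) {f : ℝ → ℝ}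
    (h : ∀ k ≤ m, ∀ t ∈ Set.Icc a b,
      HasDerivAt (iteratedDeriv k f) (iteratedDeriv (k + 1) f t) t)
    (hint : IntervalIntegrable (iteratedDeriv (m + 1) f) volume a b)
    (hw : IntervalIntegrable
      (fun t => |iteratedDeriv (m + 1) f t| ^ p * (b - t) ^ (m + 1)) volume a b) :
    eLpNorm (fun x => f x - ∑ k ∈ Finset.range (m + 1),
        iteratedDeriv k f a * (x - a) ^ k / (Nat.factorial k : ℝ))
      (ENNReal.ofReal p) (volume.restrict (Set.Ioc a b)) ≤
    ENNReal.ofReal ((b - a) ^ (((m + 1 : ℕ) : ℝ) * (1 - 1 / p)) / (Nat.factorial (m + 1) : ℝ) *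
      (∫ t in a..b, |iteratedDeriv (m + 1) f t| ^ p * (b - t) ^ (m + 1)) ^ (1 / p)) := by
  have hp0 : 0 < p := by linarith
  have hba : 0 < b - a := sub_pos.2 hab
  set g := iteratedDeriv (m + 1) f
  set W := ∫ t in a..b, |g t| ^ p * (b - t) ^ (m + 1) with hW
  have hnn : ∀ t ∈ Set.Ioc a b, 0 ≤ |g t| ^ p * (b - t) ^ (m + 1) := fun t ht =>
    mul_nonneg (by positivity) (pow_nonneg (sub_nonneg.2 ht.2) _)
  have hW0 : 0 ≤ W := by
    rw [hW, integral_of_le hab.le]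
    exact setIntegral_nonneg measurableSet_Ioc hnn
  have hpoint : ∀ x ∈ Set.Ioc a b,
      ‖f x - ∑ k ∈ Finset.range (m + 1),
        iteratedDeriv k f a * (x - a) ^ k / (Nat.factorial k : ℝ)‖ₑ ^ p ≤
      (∫⁻ t in Set.Ioc a x, ‖g t‖ₑ * ENNReal.ofReal ((x - t) ^ m)) ^ p *
        ENNReal.ofReal (1 / (Nat.factorial m : ℝ)) ^ p := by
    intro x hx
    rw [taylor_remainder_eq_integral hx.1.le m
      (fun k hk t ht => h k hk t ⟨ht.1, ht.2.trans hx.2⟩)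
      (hint.mono_set (by
        rw [Set.uIcc_of_le hx.1.le, Set.uIcc_of_le hab.le]
        exact Set.Icc_subset_Icc_right hx.2)), integral_of_le hx.1.le,
      ← ENNReal.mul_rpow_of_nonneg _ _ hp0.le, ← lintegral_mul_const' _ _ ENNReal.ofReal_ne_top]
    refine ENNReal.rpow_le_rpow ((enorm_integral_le_lintegral_enorm _).trans
      (setLIntegral_mono' measurableSet_Ioc fun t ht => ?_)) hp0.le
    have hxt : 0 ≤ x - t := sub_nonneg.2 ht.2
    rw [div_eq_mul_one_div, enorm_mul, enorm_mul,
      Real.enorm_of_nonneg (pow_nonneg hxt m),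
      Real.enorm_of_nonneg (r := 1 / (Nat.factorial m : ℝ)) (by positivity)]
  have hweight : ∫⁻ t in Set.Ioc a b, ‖g t‖ₑ ^ p *
      ENNReal.ofReal ((b - t) ^ (m + 1) / (m + 1)) = ENNReal.ofReal (W / (m + 1)) := by
    rw [hW, ← intervalIntegral.integral_div, integral_of_le hab.le, ofReal_integral_eq_lintegral_ofReal]
    · refine setLIntegral_congr_fun measurableSet_Ioc fun t _ => ?_
      rw [Real.enorm_eq_ofReal_abs, ENNReal.ofReal_rpow_of_nonneg (abs_nonneg _) hp0.le,
        ← ENNReal.ofReal_mul (by positivity), mul_div_assoc]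
    · exact hw.1.div_const _
    · filter_upwards [ae_restrict_mem measurableSet_Ioc] with t ht
      exact div_nonneg (hnn t ht) (by positivity)
  have hF : AEMeasurable (fun t => ‖g t‖ₑ) (volume.restrict (Set.Ioc a b)) :=
    hint.1.aestronglyMeasurable.enorm
  rw [eLpNorm_eq_lintegral_rpow_enorm_toReal (by simpa using hp0) ENNReal.ofReal_ne_top,
    ENNReal.toReal_ofReal hp0.le, one_div, ENNReal.rpow_inv_le_iff hp0]
  refine (setLIntegral_mono' measurableSet_Ioc hpoint).trans ?_
  rw [lintegral_mul_const' _ _ (ENNReal.rpow_ne_top_of_nonneg hp0.le ENNReal.ofReal_ne_top)]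
  refine (mul_le_mul_left (lintegral_rpow_lintegral_mul_pow_le hp m hF) _).trans_eq ?_
  rw [hweight, ENNReal.ofReal_rpow_of_nonneg (by positivity) (sub_nonneg.2 hp),
    ENNReal.ofReal_rpow_of_nonneg (by positivity) hp0.le,
    ENNReal.ofReal_rpow_of_nonneg (by positivity) hp0.le,
    ← ENNReal.ofReal_mul (by positivity), ← ENNReal.ofReal_mul (by positivity)]
  congr 1
  have hm : (0 : ℝ) < m + 1 := by positivity
  have hfac : (0 : ℝ) < Nat.factorial m := by positivity
  have hexp : ((m + 1 : ℕ) : ℝ) * (1 - p⁻¹) * p = ((m + 1 : ℕ) : ℝ) * (p - 1) := by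
    field_simp
  rw [Real.mul_rpow (by positivity) (by positivity), ← Real.rpow_mul hW0,
    inv_mul_cancel₀ hp0.ne', Real.rpow_one,
    Real.div_rpow (y := (Nat.factorial (m + 1) : ℝ)) (by positivity) (by positivity),
    ← Real.rpow_mul hba.le, hexp, Real.rpow_natCast_mul hba.le,
    Real.div_rpow (by positivity) hm.le, Real.div_rpow zero_le_one hfac.le, Real.one_rpow,
    Nat.factorial_succ, Nat.cast_mul, Real.mul_rpow (by positivity) hfac.le, Nat.cast_add_one,
    Real.rpow_sub_one hm.ne']
  have := Real.rpow_pos_of_pos hm p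
  have := Real.rpow_pos_of_pos hfac p
  field_simp

/-- `L^p` estimate of the Taylor remainder (the `A₄` bound, weighted
integral of `|f⁽ⁿ⁾|^p` with weight `(b-t)^n`). -/
theorem taylor_remainder_Lp_A4_estimate
    (a b : ℝ) (hab : a < b) (n : ℕ) (hn : 1 ≤ n) (p : ℝ) (hp : 1 ≤ p)
    (f : ℝ → ℝ)
    (hderiv : ∀ k < n, ∀ x ∈ Set.Icc a b,
      HasDerivAt (iteratedDeriv k f) (iteratedDeriv (k + 1) f x) x)
    (hint : IntervalIntegrable (iteratedDeriv n f) volume a b)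
    (hw_int : IntervalIntegrable
      (fun t => |iteratedDeriv n f t| ^ p * (b - t) ^ n) volume a b) :
    (∫ x in a..b,
        |f x - ∑ k ∈ Finset.range (n + 1),
          iteratedDeriv k f a * (x - a) ^ k / (Nat.factorial k : ℝ)| ^ p)
      ^ (1 / p) ≤
      ((b - a) ^ ((n : ℝ) + 1 / p) /
        ((Nat.factorial n : ℝ) * ((n : ℝ) * p + 1) ^ (1 / p))) *
          |iteratedDeriv n f a| +
      ((b - a) ^ ((n : ℝ) * (1 - 1 / p)) / (Nat.factorial n : ℝ)) *
        (∫ t in a..b, |iteratedDeriv n f t| ^ p * (b - t) ^ n) ^ (1 / p) := by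
  obtain ⟨m, rfl⟩ : ∃ m, n = m + 1 := ⟨n - 1, by omega⟩
  have hp0 : 0 < p := by linarith
  have hba : 0 < b - a := sub_pos.2 hab
  have hcont : ContinuousOn f (Set.Icc a b) := fun x hx => by
    simpa using (hderiv 0 (by omega) x hx).continuousAt.continuousWithinAt
  have hbound := eLpNorm_taylor_remainder_le hab hp m
    (fun k hk => hderiv k (by omega)) hint hw_int
  have hlead := eLpNorm_const_mul_pow hab hp (m + 1)
    (iteratedDeriv (m + 1) f a / (Nat.factorial (m + 1) : ℝ))
  have hW0 : 0 ≤ ∫ t in a..b, |iteratedDeriv (m + 1) f t| ^ p * (b - t) ^ (m + 1) :=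
    integral_nonneg hab.le fun t ht =>
      mul_nonneg (by positivity) (pow_nonneg (sub_nonneg.2 ht.2) _)
  have hrem : IntegrableOn (fun x => |f x - ∑ k ∈ Finset.range (m + 1 + 1),
      iteratedDeriv k f a * (x - a) ^ k / (Nat.factorial k : ℝ)| ^ p) (Set.Ioc a b) :=
    (ContinuousOn.integrableOn_Icc (ContinuousOn.rpow_const (by fun_prop)
      fun _ _ => Or.inr hp0.le)).mono_set Set.Ioc_subset_Icc_self
  have hmeas : AEStronglyMeasurable (fun x => f x - ∑ k ∈ Finset.range (m + 1),
      iteratedDeriv k f a * (x - a) ^ k / (Nat.factorial k : ℝ))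
      (volume.restrict (Set.Ioc a b)) :=
    ContinuousOn.aestronglyMeasurable
      (ContinuousOn.mono (by fun_prop) Set.Ioc_subset_Icc_self) measurableSet_Ioc
  have htri := eLpNorm_sub_le (p := ENNReal.ofReal p) hmeas
    (g := fun x => iteratedDeriv (m + 1) f a / (Nat.factorial (m + 1) : ℝ) * (x - a) ^ (m + 1))
    (by fun_prop) (by simpa using hp)
  have hsplit : (fun x => f x - ∑ k ∈ Finset.range (m + 1),
        iteratedDeriv k f a * (x - a) ^ k / (Nat.factorial k : ℝ)) -
      (fun x => iteratedDeriv (m + 1) f a / (Nat.factorial (m + 1) : ℝ) * (x - a) ^ (m + 1)) =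
      fun x => f x - ∑ k ∈ Finset.range (m + 1 + 1),
        iteratedDeriv k f a * (x - a) ^ k / (Nat.factorial k : ℝ) := by
    ext x
    rw [Pi.sub_apply, Finset.sum_range_succ _ (m + 1)]
    ring
  rw [hsplit, eLpNorm_eq_ofReal_integral_rpow hp hrem, ← integral_of_le hab.le, hlead] at htri
  have hfinal := htri.trans (add_le_add_left hbound _)
  rw [← ENNReal.ofReal_add (by positivity) (by positivity),
    ENNReal.ofReal_le_ofReal_iff (by positivity)] at hfinal
  refine hfinal.trans_eq ?_
  rw [add_comm, abs_div, Nat.abs_cast]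
  congr 1
  field_simp
end

section
/- Let a < b be real numbers and n ≥ 1 a natural number. Suppose f : ℝ → ℝ is such that for each k ≤ n the k-th derivative f^{(k)} exists at every point of [a,b], f^{(n)} is interval-integrable on [a,b], and M is a real number with |f^{(n)}(t)| ≤ M for almost every t ∈ [a,b]. Then sup_{a ≤ x ≤ b} |R_n(x)| ≤ ((b-a)^n / n!) · |f^{(n)}(a)| + ((b-a)^n / n!) · M. -/
open MeasureTheory intervalIntegral

/-- Lagrange-type bound for the Taylor remainder of order `m` of a chain of successive derivatives
whose last member is integrable and essentially bounded by `M`. -/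
theorem abs_sub_taylor_sum_le_of_ae_bound {a b M : ℝ} (m : ℕ) (g : ℕ → ℝ → ℝ)
    (hderiv : ∀ k < m + 1, ∀ x ∈ Set.Icc a b, HasDerivAt (g k) (g (k + 1) x) x)
    (hint : IntervalIntegrable (g (m + 1)) volume a b)
    (hM : ∀ᵐ t ∂(volume : Measure ℝ), t ∈ Set.Icc a b → |g (m + 1) t| ≤ M) :
    ∀ x ∈ Set.Icc a b,
      |g 0 x - ∑ k ∈ Finset.range (m + 1), g k a * (x - a) ^ k / (Nat.factorial k : ℝ)| ≤
        M * (x - a) ^ (m + 1) / (Nat.factorial (m + 1) : ℝ) := by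
  induction m generalizing g with
  | zero =>
    intro x hx
    have hsub : Set.uIcc a x ⊆ Set.Icc a b := by
      rw [Set.uIcc_of_le hx.1]
      exact Set.Icc_subset_Icc_right hx.2
    have hftc : ∫ t in a..x, g 1 t = g 0 x - g 0 a :=
      integral_eq_sub_of_hasDerivAt (fun t ht => hderiv 0 one_pos t (hsub ht))
        (hint.mono_set (by rwa [Set.uIcc_of_le (hx.1.trans hx.2)]))
    have hle : ‖∫ t in a..x, g 1 t‖ ≤ M * |x - a| :=
      norm_integral_le_of_norm_le_const_ae <| by
        filter_upwards [hM] with t ht htx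
        exact ht (hsub (Set.uIoc_subset_uIcc htx))
    rw [hftc, abs_of_nonneg (sub_nonneg.2 hx.1), Real.norm_eq_abs] at hle
    simpa using hle
  | succ m ih =>
    have hbound := ih (fun k => g (k + 1)) (fun k hk => hderiv (k + 1) (by omega)) hint hM
    have hpow : ∀ (c : ℝ) (k : ℕ) (x : ℝ),
        HasDerivAt (fun x => c * (x - a) ^ (k + 1) / (Nat.factorial (k + 1) : ℝ))
          (c * (x - a) ^ k / (Nat.factorial k : ℝ)) x := by
      intro c k x
      have h := ((((hasDerivAt_id x).sub_const a).pow (k + 1)).const_mul c).div_const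
        (Nat.factorial (k + 1) : ℝ)
      refine h.congr_deriv ?_
      have : (Nat.factorial k : ℝ) ≠ 0 := by positivity
      rw [Nat.factorial_succ]
      push_cast
      simp only [id]
      field_simp
    have hrem : ∀ x ∈ Set.Icc a b,
        HasDerivAt
          (fun x => g 0 x - ∑ k ∈ Finset.range (m + 2),
            g k a * (x - a) ^ k / (Nat.factorial k : ℝ))
          (g 1 x - ∑ k ∈ Finset.range (m + 1),
            g (k + 1) a * (x - a) ^ k / (Nat.factorial k : ℝ)) x := by
      intro x hx
      simp_rw [Finset.sum_range_succ' _ (m + 1)]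
      refine (hderiv 0 (by omega) x hx).sub ?_
      simpa using (HasDerivAt.fun_sum fun k (_ : k ∈ Finset.range (m + 1)) =>
        hpow (g (k + 1) a) k x).add_const (g 0 a)
    intro x hx
    refine image_norm_le_of_norm_deriv_right_le_deriv_boundary
      (fun t ht => (hrem t ht).continuousAt.continuousWithinAt)
      (fun t ht => (hrem t (Set.Ico_subset_Icc_self ht)).hasDerivWithinAt) ?_
      (fun t => hpow M (m + 1) t)
      (fun t ht => hbound t (Set.Ico_subset_Icc_self ht)) hx
    simp [Finset.sum_range_succ' _ (m + 1)]

/-- Sup-norm estimate of the Taylor remainder (the `p = ∞` case of the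
alternative bound): using an essential bound `M` on `f⁽ⁿ⁾`. -/
theorem taylor_remainder_sup_Linfty_estimate
    (a b : ℝ) (hab : a < b) (n : ℕ) (hn : 1 ≤ n) (f : ℝ → ℝ)
    (hderiv : ∀ k < n, ∀ x ∈ Set.Icc a b,
      HasDerivAt (iteratedDeriv k f) (iteratedDeriv (k + 1) f x) x)
    (hint : IntervalIntegrable (iteratedDeriv n f) volume a b)
    (M : ℝ)
    (hM : ∀ᵐ t ∂(volume : Measure ℝ), t ∈ Set.Icc a b → |iteratedDeriv n f t| ≤ M) :
    (⨆ x : Set.Icc a b,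
        |f (x : ℝ) - ∑ k ∈ Finset.range (n + 1),
          iteratedDeriv k f a * ((x : ℝ) - a) ^ k / (Nat.factorial k : ℝ)|) ≤
      ((b - a) ^ n / (Nat.factorial n : ℝ)) * |iteratedDeriv n f a| +
      ((b - a) ^ n / (Nat.factorial n : ℝ)) * M := by
  obtain ⟨m, rfl⟩ : ∃ m, n = m + 1 := ⟨n - 1, by omega⟩
  have hbound := abs_sub_taylor_sum_le_of_ae_bound m (fun k => iteratedDeriv k f) hderiv hint hM
  simp only [iteratedDeriv_zero] at hbound
  have hba : 0 < b - a := sub_pos.2 hab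
  have hM0 : 0 ≤ M := by
    have h := (abs_nonneg _).trans (hbound b (Set.right_mem_Icc.2 hab.le))
    rw [mul_div_assoc] at h
    exact nonneg_of_mul_nonneg_left h (by positivity)
  have : Nonempty (Set.Icc a b) := ⟨⟨a, Set.left_mem_Icc.2 hab.le⟩⟩
  refine ciSup_le fun ⟨x, hx⟩ => ?_
  have hxa : 0 ≤ x - a := sub_nonneg.2 hx.1
  have hcoeff : (x - a) ^ (m + 1) / (Nat.factorial (m + 1) : ℝ) ≤
      (b - a) ^ (m + 1) / (Nat.factorial (m + 1) : ℝ) := by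
    gcongr
    exact hx.2
  have hlast : |iteratedDeriv (m + 1) f a * (x - a) ^ (m + 1) / (Nat.factorial (m + 1) : ℝ)| =
      (x - a) ^ (m + 1) / (Nat.factorial (m + 1) : ℝ) * |iteratedDeriv (m + 1) f a| := by
    rw [mul_div_assoc, abs_mul, mul_comm, abs_of_nonneg (by positivity)]
  rw [Finset.sum_range_succ, ← sub_sub]
  refine (abs_sub _ _).trans ?_
  rw [hlast, add_comm]
  refine add_le_add (mul_le_mul_of_nonneg_right hcoeff (abs_nonneg _)) ?_
  refine (hbound x hx).trans ?_
  rw [mul_div_assoc, mul_comm]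
  exact mul_le_mul_of_nonneg_right hcoeff hM0
end

section
/- Let a < b be real numbers and n ≥ 1 a natural number. Suppose f : ℝ → ℝ is such that for each k ≤ n the k-th derivative f^{(k)} exists at every point of [a,b], and f^{(n)} is continuous on [a,b]. Then for all y ∈ [a,b], ∫_a^y R_n(x) dx = (1/n!) ∫_a^y [f^{(n)}(t) - f^{(n)}(a)](y-t)^n dt. -/
open MeasureTheory intervalIntegral

/-- The antiderivative in `t` of `(y - t) ^ m` vanishing at `t = y`. -/
lemma hasDerivAt_neg_sub_pow_div (y t : ℝ) (m : ℕ) :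
    HasDerivAt (fun s : ℝ => -((y - s) ^ (m + 1) / (m + 1 : ℝ))) ((y - t) ^ m) t := by
  have h := ((((hasDerivAt_id t).const_sub y).pow (m + 1)).div_const (m + 1 : ℝ)).neg
  have hm : (m + 1 : ℝ) ≠ 0 := by positivity
  refine h.congr_deriv ?_
  simp
  field_simp

/-- Repeated integration by parts: if `g (k + 1)` is the derivative of `g k` on `[a, y]` for
`k < m` and `g m` is continuous there, then `∫ g 0` expands around `a` to order `m`. -/
lemma integral_eq_sum_add_integral_mul_sub_pow {a y : ℝ} (hay : a ≤ y) (g : ℕ → ℝ → ℝ) (m : ℕ)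
    (hderiv : ∀ k < m, ∀ x ∈ Set.Icc a y, HasDerivAt (g k) (g (k + 1) x) x)
    (hcont : ContinuousOn (g m) (Set.Icc a y)) :
    ∫ x in a..y, g 0 x =
      ∑ k ∈ Finset.range m, g k a * (y - a) ^ (k + 1) / (Nat.factorial (k + 1) : ℝ) +
        1 / (Nat.factorial m : ℝ) * ∫ t in a..y, g m t * (y - t) ^ m := by
  induction m with
  | zero => simp
  | succ m ih =>
    rw [ih (fun k hk => hderiv k (by omega))
      fun x hx => (hderiv m (by omega) x hx).continuousAt.continuousWithinAt]
    have hparts := integral_mul_deriv_eq_deriv_mul (a := a) (b := y)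
      (fun x hx => hderiv m (by omega) x (by rwa [Set.uIcc_of_le hay] at hx))
      (fun x _ => hasDerivAt_neg_sub_pow_div y x m)
      (ContinuousOn.intervalIntegrable (by rwa [Set.uIcc_of_le hay]))
      (Continuous.intervalIntegrable (by fun_prop) a y)
    have hrem : ∫ t in a..y, g (m + 1) t * -((y - t) ^ (m + 1) / (m + 1 : ℝ)) =
        -(1 / (m + 1 : ℝ)) * ∫ t in a..y, g (m + 1) t * (y - t) ^ (m + 1) := by
      rw [← intervalIntegral.integral_const_mul]
      congr 1
      ext t
      ring
    rw [hparts, hrem, Finset.sum_range_succ, Nat.factorial_succ]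
    have hm : (m + 1 : ℝ) ≠ 0 := by positivity
    have hfact : (Nat.factorial m : ℝ) ≠ 0 := by positivity
    push_cast
    simp only [sub_self, ne_eq, Nat.succ_ne_zero, not_false_eq_true, zero_pow, zero_div, neg_zero,
      mul_zero]
    field_simp
    ring

/-- Integral identity for the Taylor remainder when `f⁽ⁿ⁾` is merely
continuous on `[a,b]`. -/
theorem taylor_remainder_integral_identity_continuous
    (a b : ℝ) (hab : a < b) (n : ℕ) (hn : 1 ≤ n) (f : ℝ → ℝ)
    (hderiv : ∀ k < n, ∀ x ∈ Set.Icc a b,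
      HasDerivAt (iteratedDeriv k f) (iteratedDeriv (k + 1) f x) x)
    (hcont : ContinuousOn (iteratedDeriv n f) (Set.Icc a b)) :
    ∀ y ∈ Set.Icc a b,
      (∫ x in a..y,
        (f x - ∑ k ∈ Finset.range (n + 1),
          iteratedDeriv k f a * (x - a) ^ k / (Nat.factorial k : ℝ))) =
      (1 / (Nat.factorial n : ℝ)) *
        ∫ t in a..y, (iteratedDeriv n f t - iteratedDeriv n f a) * (y - t) ^ n := by
  intro y hy
  have hsub : Set.Icc a y ⊆ Set.Icc a b := Set.Icc_subset_Icc_right hy.2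
  have hcont' : ContinuousOn (iteratedDeriv n f) (Set.uIcc a y) := by
    rw [Set.uIcc_of_le hy.1]
    exact hcont.mono hsub
  have hf : ContinuousOn f (Set.uIcc a y) := by
    rw [Set.uIcc_of_le hy.1]
    intro x hx
    simpa using (hderiv 0 hn x (hsub hx)).continuousAt.continuousWithinAt
  have hexpand := integral_eq_sum_add_integral_mul_sub_pow hy.1 (fun k => iteratedDeriv k f) n
    (fun k hk x hx => hderiv k hk x (hsub hx)) (hcont.mono hsub)
  simp only [iteratedDeriv_zero] at hexpand
  have hmonomial (k : ℕ) :
      ∫ x in a..y, iteratedDeriv k f a * (x - a) ^ k / (Nat.factorial k : ℝ) =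
        iteratedDeriv k f a * (y - a) ^ (k + 1) / (Nat.factorial (k + 1) : ℝ) := by
    have hfact : (Nat.factorial k : ℝ) ≠ 0 := by positivity
    rw [intervalIntegral.integral_div, intervalIntegral.integral_const_mul,
      intervalIntegral.integral_comp_sub_right (fun x => x ^ k), integral_pow, Nat.factorial_succ]
    push_cast
    simp
    field_simp
  have hconst : ∫ t in a..y, iteratedDeriv n f a * (y - t) ^ n =
      iteratedDeriv n f a * ((y - a) ^ (n + 1) / (n + 1 : ℝ)) := by
    rw [intervalIntegral.integral_const_mul,
      intervalIntegral.integral_comp_sub_left (fun x => x ^ n), integral_pow]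
    simp
  have hint : IntervalIntegrable (fun t => iteratedDeriv n f t * (y - t) ^ n) volume a y :=
    ContinuousOn.intervalIntegrable (hcont'.mul (by fun_prop))
  simp only [sub_mul]
  rw [intervalIntegral.integral_sub hf.intervalIntegrable
      (Continuous.intervalIntegrable (by fun_prop) a y),
    intervalIntegral.integral_finsetSum
      (fun k _ => Continuous.intervalIntegrable (by fun_prop) a y),
    intervalIntegral.integral_sub hint
      (Continuous.intervalIntegrable (by fun_prop) a y),
    hexpand, hconst, Finset.sum_congr rfl (fun k _ => hmonomial k), Finset.sum_range_succ,
    Nat.factorial_succ]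
  have hfact : (Nat.factorial n : ℝ) ≠ 0 := by positivity
  push_cast
  field_simp
  ring
end
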